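/- arXiv:1012.1072 — 2 statements merged into one kernel-verified Lean document; each statement's English description precedes it below -/
import Mathlib

section
/- Skew-adjointness of the operator φ̂_w with respect to the trace pairing (identity (q00602)): For every w ∈ ℂ with w ∉ Γ_τ and −w ∉ Γ_τ, and all A, B ∈ sl(N,ℂ), one has ⟨A φ̂_w(B)⟩ = −⟨B φ̂_{−w}(A)⟩, where A and B are expanded in the basis {T_γ : γ ∈ Γ'_N}. -/
open scoped BigOperators
open Complex Matrix Finset

noncomputable section

/-- The lattice `Γ_τ = ℤ + τℤ`. -/
def latticeGamma (τ : ℂ) : Set ℂ := {w | ∃ m n : ℤ, w = (m : ℂ) + (n : ℂ) * τ}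

/-- The odd theta function `ϑ(z|τ)`. -/
def theta (τ z : ℂ) : ℂ :=
  Complex.exp (2 * (Real.pi : ℂ) * Complex.I * τ / 8) *
    ∑' m : ℤ, (-1 : ℂ) ^ m *
      Complex.exp (2 * (Real.pi : ℂ) * Complex.I * ((m : ℂ) * ((m : ℂ) + 1) * τ / 2 + (m : ℂ) * z))

/-- The first Eisenstein function `E₁(z) = ϑ'(z)/ϑ(z)`. -/
def E1 (τ z : ℂ) : ℂ := deriv (theta τ) z / theta τ z

/-- The second Eisenstein function `E₂(z) = −E₁'(z)`. -/
def E2 (τ z : ℂ) : ℂ := -deriv (E1 τ) z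

/-- The constant `η₁` determined by `E₁(z) = 1/z − 2η₁z + O(z³)` near `z = 0`. -/
def eta1 (τ : ℂ) : ℂ :=
  -(deriv (fun z : ℂ => if z = 0 then 0 else E1 τ z - 1 / z) 0) / 2

/-- The Weierstrass function `℘(z) = E₂(z) − 2η₁`. -/
def wp (τ z : ℂ) : ℂ := E2 τ z - 2 * eta1 τ

/-- The Kronecker function `φ(u,z) = ϑ(u+z)ϑ'(0)/(ϑ(u)ϑ(z))`. -/
def kronPhi (τ u z : ℂ) : ℂ := theta τ (u + z) * deriv (theta τ) 0 / (theta τ u * theta τ z)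

/-- `f(u,z) = ∂_u φ(u,z)`. -/
def kronF (τ u z : ℂ) : ℂ := deriv (fun u' => kronPhi τ u' z) u

/-- `e_N(z) = exp(2πiz/N)`. -/
def eN (N : ℕ) (z : ℂ) : ℂ := Complex.exp (2 * (Real.pi : ℂ) * Complex.I * z / N)

/-- The matrix `Q = diag(e_N(1),…,e_N(N−1),1)`. -/
def Qm (N : ℕ) : Matrix (Fin N) (Fin N) ℂ :=
  Matrix.diagonal fun i => eN N ((i : ℕ) + 1)

/-- The cyclic shift matrix `Λ`. -/
def Lm (N : ℕ) : Matrix (Fin N) (Fin N) ℂ :=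
  Matrix.of fun i j => if ((i : ℕ) + 1) % N = (j : ℕ) then 1 else 0

/-- The basis matrices `T_γ = e_N(γ₁γ₂/2) Q^{γ₁} Λ^{γ₂}` for `γ ∈ ℤ²`. -/
def Tm (N : ℕ) (γ : ℤ × ℤ) : Matrix (Fin N) (Fin N) ℂ :=
  eN N (((γ.1 * γ.2 : ℤ) : ℂ) / 2) • (Qm N ^ γ.1 * Lm N ^ γ.2)

/-- `ω_γ = (γ₁ + γ₂τ)/N`. -/
def om (N : ℕ) (τ : ℂ) (γ : ℤ × ℤ) : ℂ := ((γ.1 : ℂ) + (γ.2 : ℂ) * τ) / N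

/-- `φ_γ(z) = e_N(γ₂z) φ(ω_γ, z)`. -/
def phiG (N : ℕ) (τ : ℂ) (γ : ℤ × ℤ) (z : ℂ) : ℂ := eN N ((γ.2 : ℂ) * z) * kronPhi τ (om N τ γ) z

/-- `f_γ(z) = e_N(γ₂z) f(ω_γ, z)`. -/
def fG (N : ℕ) (τ : ℂ) (γ : ℤ × ℤ) (z : ℂ) : ℂ := eN N ((γ.2 : ℂ) * z) * kronF τ (om N τ γ) z

/-- `F_γ(z) = φ_γ(z)E₁(z) − f_γ(z)`. -/
def FG (N : ℕ) (τ : ℂ) (γ : ℤ × ℤ) (z : ℂ) : ℂ := phiG N τ γ z * E1 τ z - fG N τ γ z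

/-- A fixed set of representatives of the nonzero classes of `(ℤ/Nℤ)²`. -/
def GammaN' (N : ℕ) : Finset (ℤ × ℤ) :=
  ((Finset.range N ×ˢ Finset.range N).image fun p => ((p.1 : ℤ), (p.2 : ℤ))) \ {(0, 0)}


theorem aux_theta_add_one (τ z : ℂ) : theta τ (z + 1) = theta τ z := by
  unfold theta
  congr 1
  refine tsum_congr fun m => ?_
  congr 1
  have h := Complex.exp_int_mul_two_pi_mul_I m
  rw [show 2 * (Real.pi : ℂ) * Complex.I * ((m : ℂ) * ((m : ℂ) + 1) * τ / 2 + (m : ℂ) * (z + 1))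
    = 2 * (Real.pi : ℂ) * Complex.I * ((m : ℂ) * ((m : ℂ) + 1) * τ / 2 + (m : ℂ) * z)
      + m * (2 * (Real.pi : ℂ) * Complex.I) by ring, Complex.exp_add, h, mul_one]

theorem aux_theta_add_tau (τ z : ℂ) :
    theta τ (z + τ) = -Complex.exp (-(2 * (Real.pi : ℂ) * Complex.I * (τ + z))) * theta τ z := by
  unfold theta
  rw [mul_left_comm]
  congr 1
  rw [← tsum_mul_left, ← (Equiv.addRight (-1 : ℤ)).tsum_eq]
  refine tsum_congr fun m => ?_
  simp only [Equiv.coe_addRight]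
  have h1 : (-1 : ℂ) ^ (m + -1) = -(-1 : ℂ) ^ m := by
    rw [zpow_add₀ (by norm_num)]; norm_num
  rw [h1]
  have h2 : Complex.exp (2 * (Real.pi : ℂ) * Complex.I *
      (((m + -1 : ℤ) : ℂ) * (((m + -1 : ℤ) : ℂ) + 1) * τ / 2 + ((m + -1 : ℤ) : ℂ) * (z + τ)))
      = Complex.exp (-(2 * (Real.pi : ℂ) * Complex.I * (τ + z))) *
        Complex.exp (2 * (Real.pi : ℂ) * Complex.I *
          ((m : ℂ) * ((m : ℂ) + 1) * τ / 2 + (m : ℂ) * z)) := by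
    rw [← Complex.exp_add]
    congr 1
    push_cast
    ring
  rw [h2]
  ring

theorem aux_theta_neg (τ z : ℂ) :
    theta τ (-z) = -Complex.exp (2 * (Real.pi : ℂ) * Complex.I * z) * theta τ z := by
  unfold theta
  rw [mul_left_comm]
  congr 1
  rw [← tsum_mul_left, ← (Equiv.subLeft (-1 : ℤ)).tsum_eq]
  refine tsum_congr fun m => ?_
  simp only [Equiv.subLeft_apply]
  have h1 : (-1 : ℂ) ^ (-1 - m) = -(-1 : ℂ) ^ m := by
    rw [zpow_sub₀ (by norm_num)]
    rcases Int.even_or_odd m with h | h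
    · rw [h.neg_one_zpow]; norm_num
    · rw [h.neg_one_zpow]; norm_num
  rw [h1]
  have h2 : Complex.exp (2 * (Real.pi : ℂ) * Complex.I *
      (((-1 - m : ℤ) : ℂ) * (((-1 - m : ℤ) : ℂ) + 1) * τ / 2 + ((-1 - m : ℤ) : ℂ) * (-z)))
      = Complex.exp (2 * (Real.pi : ℂ) * Complex.I * z) *
        Complex.exp (2 * (Real.pi : ℂ) * Complex.I *
          ((m : ℂ) * ((m : ℂ) + 1) * τ / 2 + (m : ℂ) * z)) := by
    rw [← Complex.exp_add]
    congr 1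
    push_cast
    ring
  rw [h2]
  ring

theorem aux_kron_add_one (τ u z : ℂ) : kronPhi τ (u + 1) z = kronPhi τ u z := by
  unfold kronPhi
  rw [aux_theta_add_one, show u + 1 + z = (u + z) + 1 by ring, aux_theta_add_one]

theorem aux_kron_add_tau (τ u z : ℂ) :
    kronPhi τ (u + τ) z = Complex.exp (-(2 * (Real.pi : ℂ) * Complex.I * z)) * kronPhi τ u z := by
  unfold kronPhi
  rw [aux_theta_add_tau, show u + τ + z = (u + z) + τ by ring, aux_theta_add_tau]
  have h : Complex.exp (-(2 * (Real.pi : ℂ) * Complex.I * (τ + (u + z))))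
      = Complex.exp (-(2 * (Real.pi : ℂ) * Complex.I * (τ + u)))
        * Complex.exp (-(2 * (Real.pi : ℂ) * Complex.I * z)) := by
    rw [← Complex.exp_add]; congr 1; ring
  rw [h]
  have h0 := Complex.exp_ne_zero (-(2 * (Real.pi : ℂ) * Complex.I * (τ + u)))
  generalize Complex.exp (-(2 * (Real.pi : ℂ) * Complex.I * (τ + u))) = x at *
  rw [show -x * theta τ u * theta τ z = (-x) * (theta τ u * theta τ z) by ring,
    ← mul_div_assoc, ← mul_div_mul_left _ (theta τ u * theta τ z) (neg_ne_zero.mpr h0)]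
  congr 1
  ring

theorem aux_kron_neg (τ u z : ℂ) : kronPhi τ (-u) (-z) = -kronPhi τ u z := by
  unfold kronPhi
  rw [show -u + -z = -(u + z) by ring, aux_theta_neg, aux_theta_neg, aux_theta_neg]
  have h : Complex.exp (2 * (Real.pi : ℂ) * Complex.I * (u + z))
      = Complex.exp (2 * (Real.pi : ℂ) * Complex.I * u)
        * Complex.exp (2 * (Real.pi : ℂ) * Complex.I * z) := by
    rw [← Complex.exp_add]; congr 1; ring
  rw [h]
  have h0 := Complex.exp_ne_zero (2 * (Real.pi : ℂ) * Complex.I * u)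
  have h1 := Complex.exp_ne_zero (2 * (Real.pi : ℂ) * Complex.I * z)
  generalize Complex.exp (2 * (Real.pi : ℂ) * Complex.I * u) = x at *
  generalize Complex.exp (2 * (Real.pi : ℂ) * Complex.I * z) = y at *
  rw [← neg_div, ← mul_div_mul_left _ (theta τ u * theta τ z) (mul_ne_zero h0 h1)]
  congr 1 <;> ring

theorem aux_phi_add_one (N : ℕ) (hN : N ≠ 0) (τ : ℂ) (a b : ℤ) (z : ℂ) :
    phiG N τ (a + N, b) z = phiG N τ (a, b) z := by
  have hN' : (N : ℂ) ≠ 0 := Nat.cast_ne_zero.mpr hN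
  unfold phiG
  have : om N τ (a + N, b) = om N τ (a, b) + 1 := by
    unfold om; push_cast; field_simp; ring
  rw [this, aux_kron_add_one]

theorem aux_phi_add_tau (N : ℕ) (hN : N ≠ 0) (τ : ℂ) (a b : ℤ) (z : ℂ) :
    phiG N τ (a, b + N) z = phiG N τ (a, b) z := by
  have hN' : (N : ℂ) ≠ 0 := Nat.cast_ne_zero.mpr hN
  unfold phiG
  have : om N τ (a, b + N) = om N τ (a, b) + τ := by
    unfold om; push_cast; field_simp; ring
  rw [this, aux_kron_add_tau, ← mul_assoc]
  congr 1
  unfold eN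
  rw [← Complex.exp_add]
  congr 1
  push_cast
  field_simp
  ring

theorem aux_phi_neg (N : ℕ) (τ : ℂ) (a b : ℤ) (z : ℂ) :
    phiG N τ (-a, -b) z = -phiG N τ (a, b) (-z) := by
  unfold phiG
  have : om N τ (-a, -b) = -om N τ (a, b) := by
    unfold om; push_cast; ring
  have h := aux_kron_neg τ (om N τ (a, b)) (-z)
  rw [neg_neg] at h
  rw [this, h]
  push_cast
  rw [show -(b : ℂ) * z = b * -z by ring]
  ring

theorem aux_phi_pair (N : ℕ) (hN : N ≠ 0) (τ : ℂ) (a b c d : ℤ) (z : ℂ)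
    (h1 : a + c = 0 ∨ a + c = N) (h2 : b + d = 0 ∨ b + d = N) :
    phiG N τ (c, d) z = -phiG N τ (a, b) (-z) := by
  rw [← aux_phi_neg]
  rcases h1 with h1 | h1 <;> rcases h2 with h2 | h2
  · rw [show c = -a by omega, show d = -b by omega]
  · rw [show c = -a by omega, show d = -b + N by omega, aux_phi_add_tau N hN]
  · rw [show c = -a + N by omega, show d = -b by omega, aux_phi_add_one N hN]
  · rw [show c = -a + N by omega, show d = -b + N by omega, aux_phi_add_tau N hN,
      aux_phi_add_one N hN]

theorem aux_trace_zero {N : ℕ} (X X' M : Matrix (Fin N) (Fin N) ℂ) (c : ℂ) (hc : c ≠ 1)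
    (hX : X * X' = 1) (h : X * M = c • (M * X)) : Matrix.trace M = 0 := by
  have hX' : X' * X = 1 := mul_eq_one_comm.mp hX
  have e : Matrix.trace (X * M * X') = c * Matrix.trace M := by
    rw [h, Matrix.smul_mul, Matrix.trace_smul, Matrix.mul_assoc, hX, Matrix.mul_one, smul_eq_mul]
  rw [Matrix.trace_mul_comm, ← Matrix.mul_assoc, hX', Matrix.one_mul] at e
  have : (c - 1) * Matrix.trace M = 0 := by linear_combination -e
  exact (mul_eq_zero.mp this).resolve_left (sub_ne_zero.mpr hc)

/-- `X` and `M` commute up to the scalar `c`. -/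
def AuxComm {N : ℕ} (X : Matrix (Fin N) (Fin N) ℂ) (c : ℂ) (M : Matrix (Fin N) (Fin N) ℂ) : Prop :=
  X * M = c • (M * X)

theorem AuxComm.mul' {N : ℕ} {X M M' : Matrix (Fin N) (Fin N) ℂ} {c c' : ℂ}
    (h : AuxComm X c M) (h' : AuxComm X c' M') : AuxComm X (c * c') (M * M') := by
  unfold AuxComm at *
  rw [← Matrix.mul_assoc, h, Matrix.smul_mul, Matrix.mul_assoc, h', Matrix.mul_smul, smul_smul,
    Matrix.mul_assoc]

theorem AuxComm.pow' {N : ℕ} {X M : Matrix (Fin N) (Fin N) ℂ} {c : ℂ}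
    (h : AuxComm X c M) (n : ℕ) : AuxComm X (c ^ n) (M ^ n) := by
  induction n with
  | zero => simp [AuxComm]
  | succ k ih => rw [pow_succ, pow_succ]; exact ih.mul' h

theorem aux_self {N : ℕ} (X : Matrix (Fin N) (Fin N) ℂ) : AuxComm X 1 X := by
  simp [AuxComm]

theorem aux_eN_mod (N : ℕ) (hN : N ≠ 0) (k : ℕ) : eN N ((k % N : ℕ) : ℂ) = eN N k := by
  have hN' : (N : ℂ) ≠ 0 := Nat.cast_ne_zero.mpr hN
  conv_rhs => rw [← Nat.mod_add_div k N]
  unfold eN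
  have h := Complex.exp_int_mul_two_pi_mul_I ((k / N : ℕ) : ℤ)
  rw [Int.cast_natCast] at h
  rw [← mul_one (Complex.exp (2 * (Real.pi : ℂ) * Complex.I * ((k % N : ℕ) : ℂ) / N)),
    ← h, ← Complex.exp_add]
  congr 1
  rw [Nat.cast_add, Nat.cast_mul]
  field_simp

theorem aux_eN_add (N : ℕ) (x y : ℂ) : eN N (x + y) = eN N x * eN N y := by
  unfold eN
  rw [← Complex.exp_add]
  congr 1
  ring

theorem aux_LQ (N : ℕ) (hN : N ≠ 0) : AuxComm (Lm N) (eN N 1) (Qm N) := by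
  unfold AuxComm
  ext i j
  rw [Qm, Matrix.mul_diagonal, Matrix.smul_apply, Matrix.diagonal_mul]
  simp only [Lm, Matrix.of_apply]
  split_ifs with h
  · rw [← h, one_mul, mul_one, smul_eq_mul, aux_eN_add, aux_eN_mod N hN, mul_comm]
    push_cast
    rfl
  · simp

theorem aux_eN_ne (N : ℕ) (x : ℂ) : eN N x ≠ 0 := Complex.exp_ne_zero _

theorem aux_QL (N : ℕ) (hN : N ≠ 0) : AuxComm (Qm N) (eN N 1)⁻¹ (Lm N) := by
  have h := aux_LQ N hN
  unfold AuxComm at *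
  rw [h, smul_smul, inv_mul_cancel₀ (aux_eN_ne N 1), one_smul]

theorem aux_Q_inv (N : ℕ) :
    Qm N * Matrix.diagonal (fun i : Fin N => (eN N ((i : ℕ) + 1))⁻¹) = 1 := by
  rw [Qm, Matrix.diagonal_mul_diagonal, ← Matrix.diagonal_one]
  congr 1
  ext i
  exact mul_inv_cancel₀ (aux_eN_ne N _)

theorem aux_L_inv (N : ℕ) (hN : N ≠ 0) : Lm N * (Lm N)ᵀ = 1 := by
  ext i k
  rw [Matrix.mul_apply, Matrix.one_apply]
  simp only [Lm, Matrix.transpose_apply, Matrix.of_apply]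
  have hlt : ((i : ℕ) + 1) % N < N := Nat.mod_lt _ (Nat.pos_of_ne_zero hN)
  rw [Finset.sum_eq_single (⟨((i : ℕ) + 1) % N, hlt⟩ : Fin N)]
  · simp only [if_true, one_mul]
    congr 1
    apply propext
    constructor
    · intro h
      have h' : (k : ℕ) ≡ i [MOD N] := Nat.ModEq.add_right_cancel' 1 h
      exact Fin.ext (Nat.ModEq.eq_of_lt_of_lt h' k.2 i.2).symm
    · rintro rfl; rfl
  · intro j _ hj
    rw [if_neg, zero_mul]
    intro h
    exact hj (Fin.ext h.symm)
  · intro h; exact absurd (Finset.mem_univ _) h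

theorem aux_prim (N : ℕ) (hN : N ≠ 0) : IsPrimitiveRoot (eN N 1) N := by
  have h := Complex.isPrimitiveRoot_exp N hN
  unfold eN
  rwa [mul_one]

theorem aux_trace_TT (N : ℕ) (hN : N ≠ 0) (a b c d : ℕ)
    (h : ¬ (N ∣ a + c ∧ N ∣ b + d)) :
    Matrix.trace (Tm N ((a : ℤ), (b : ℤ)) * Tm N ((c : ℤ), (d : ℤ))) = 0 := by
  unfold Tm
  simp only [zpow_natCast]
  rw [Matrix.smul_mul, Matrix.mul_smul, Matrix.trace_smul, Matrix.trace_smul]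
  suffices Matrix.trace (Qm N ^ a * Lm N ^ b * (Qm N ^ c * Lm N ^ d)) = 0 by
    rw [this, smul_zero, smul_zero]
  by_cases h1 : N ∣ a + c
  · have h2 : ¬ N ∣ b + d := fun h2 => h ⟨h1, h2⟩
    refine aux_trace_zero _ _ _ _ ?_ (aux_Q_inv N)
      ((((aux_self (Qm N)).pow' a).mul' ((aux_QL N hN).pow' b)).mul'
        (((aux_self (Qm N)).pow' c).mul' ((aux_QL N hN).pow' d)))
    rw [one_pow, one_pow, one_mul, one_mul, ← pow_add, Ne, (aux_prim N hN).inv.pow_eq_one_iff_dvd]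
    exact h2
  · refine aux_trace_zero _ _ _ _ ?_ (aux_L_inv N hN)
      ((((aux_LQ N hN).pow' a).mul' ((aux_self (Lm N)).pow' b)).mul'
        (((aux_LQ N hN).pow' c).mul' ((aux_self (Lm N)).pow' d)))
    rw [one_pow, one_pow, mul_one, mul_one, ← pow_add, Ne, (aux_prim N hN).pow_eq_one_iff_dvd]
    exact h1

theorem aux_dvd (N x y : ℕ) (hx : x < N) (hy : y < N) (h : N ∣ x + y) :
    (x : ℤ) + y = 0 ∨ (x : ℤ) + y = N := by
  obtain ⟨k, hk⟩ := h
  have : k < 2 := by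
    by_contra hc
    have : N * 2 ≤ N * k := Nat.mul_le_mul_left _ (by omega)
    omega
  interval_cases k
  · left; omega
  · right; omega

theorem aux_mem (N : ℕ) (γ : ℤ × ℤ) (h : γ ∈ GammaN' N) :
    ∃ a b : ℕ, a < N ∧ b < N ∧ γ = ((a : ℤ), (b : ℤ)) := by
  unfold GammaN' at h
  rw [Finset.mem_sdiff, Finset.mem_image] at h
  obtain ⟨⟨p, hp, rfl⟩, -⟩ := h
  rw [Finset.mem_product, Finset.mem_range, Finset.mem_range] at hp
  exact ⟨p.1, p.2, hp.1, hp.2, rfl⟩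

/-- **Skew-adjointness of `φ̂_w`** (identity (q00602)): for all `A, B ∈ sl(N,ℂ)` expanded
in the basis `{T_γ : γ ∈ Γ'_N}`, `⟨A φ̂_w(B)⟩ = −⟨B φ̂_{−w}(A)⟩`. -/
theorem phiHat_skew_adjoint
    (τ : ℂ) (hτ : 0 < τ.im) (N : ℕ) (hN : 2 ≤ N)
    (w : ℂ) (hw : w ∉ latticeGamma τ) (hw' : -w ∉ latticeGamma τ)
    (A B : (ℤ × ℤ) → ℂ) :
    Matrix.trace
        ((∑ γ ∈ GammaN' N, A γ • Tm N γ)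
          * (∑ γ ∈ GammaN' N, (B γ * phiG N τ γ w) • Tm N γ))
      = -Matrix.trace
          ((∑ γ ∈ GammaN' N, B γ • Tm N γ)
            * (∑ γ ∈ GammaN' N, (A γ * phiG N τ γ (-w)) • Tm N γ)) := by
  have hN0 : N ≠ 0 := by omega
  rw [Finset.sum_mul_sum, Finset.sum_mul_sum, Matrix.trace_sum, Matrix.trace_sum]
  simp only [Matrix.trace_sum, Matrix.smul_mul, Matrix.mul_smul, Matrix.trace_smul, smul_eq_mul]
  rw [Finset.sum_comm, ← Finset.sum_neg_distrib]
  refine Finset.sum_congr rfl fun β hβ => ?_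
  rw [← Finset.sum_neg_distrib]
  refine Finset.sum_congr rfl fun α hα => ?_
  rw [Matrix.trace_mul_comm (Tm N β) (Tm N α)]
  obtain ⟨a, b, ha, hb, rfl⟩ := aux_mem N α hα
  obtain ⟨c, d, hc, hd, rfl⟩ := aux_mem N β hβ
  by_cases h : N ∣ a + c ∧ N ∣ b + d
  · rw [aux_phi_pair N hN0 τ a b c d w (aux_dvd N a c ha hc h.1) (aux_dvd N b d hb hd h.2)]
    ring
  · rw [aux_trace_TT N hN0 a b c d h]
    ring

end
end

section
/- First flows of the 1+1 elliptic sl(N) Gaudin hierarchy (Proposition 3.1): Let z_1,…,z_n ∈ ℂ satisfy z_a − z_c ∉ Γ_τ for all a ≠ c, fix a ∈ {1,…,n} and k ∈ ℂ. Let S^c(x,t) = ∑_{γ∈Γ'_N} S^c_γ(x,t) T_γ with continuously differentiable coefficients S^c_γ : ℝ² → ℂ. Define L(x,t,z) = ∑_{c=1}^n ∑_{γ∈Γ'_N} S^c_γ(x,t) T_γ φ_γ(z − z_c) and M_a(x,t,z) = ∑_{γ∈Γ'_N} S^a_γ(x,t) T_γ φ_γ(z − z_a). Then the zero-curvature equation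 ∂_t L − k ∂_x M_a = [L, M_a] holds for all (x,t) and all z with z − z_c ∉ Γ_τ for every c, if and only if for all (x,t): ∂_t S^a − k ∂_x S^a = −∑_{c≠a} [S^a, φ̂_{z_a−z_c}(S^c)] and ∂_t S^b = [S^b, φ̂_{z_b−z_a}(S^a)] for every b ≠ a. -/
open scoped BigOperators
open Complex Matrix Finset

noncomputable section

/-- The matrix `S^c(x,t) = ∑_{γ∈Γ'_N} S^c_γ(x,t) T_γ`. -/
def Smat2 (N : ℕ) {n : ℕ} (S : Fin n → (ℤ × ℤ) → ℝ → ℝ → ℂ) (c : Fin n) (x t : ℝ) :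
    Matrix (Fin N) (Fin N) ℂ :=
  ∑ γ ∈ GammaN' N, S c γ x t • Tm N γ

/-- `φ̂_w(S^c(x,t))`. -/
def phiHatS2 (N : ℕ) (τ : ℂ) {n : ℕ} (S : Fin n → (ℤ × ℤ) → ℝ → ℝ → ℂ) (w : ℂ) (c : Fin n)
    (x t : ℝ) : Matrix (Fin N) (Fin N) ℂ :=
  ∑ γ ∈ GammaN' N, (S c γ x t * phiG N τ γ w) • Tm N γ

/-! ### Theta function -/

def ex (z : ℂ) : ℂ := Complex.exp (2 * (Real.pi : ℂ) * Complex.I * z)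

lemma ex_add (a b : ℂ) : ex (a + b) = ex a * ex b := by
  unfold ex; rw [← Complex.exp_add]; ring_nf

lemma ex_ne (a : ℂ) : ex a ≠ 0 := Complex.exp_ne_zero _

lemma ex_zero : ex 0 = 1 := by simp [ex]

lemma ex_int (m : ℤ) : ex m = 1 := by
  unfold ex; rw [Complex.exp_eq_one_iff]; exact ⟨m, by ring⟩

lemma ex_eq_one {a : ℂ} (h : ex a = 1) : ∃ m : ℤ, a = m := by
  unfold ex at h; rw [Complex.exp_eq_one_iff] at h
  obtain ⟨m, hm⟩ := h
  refine ⟨m, ?_⟩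
  have : (2 * (Real.pi : ℂ) * Complex.I) ≠ 0 := Complex.two_pi_I_ne_zero
  apply mul_left_cancel₀ this
  rw [hm]; ring

lemma ex_half : ex (1/2) = -1 := by
  unfold ex
  rw [show 2 * (Real.pi : ℂ) * Complex.I * (1/2) = Real.pi * Complex.I by ring, Complex.exp_pi_mul_I]

lemma ex_half_int (m : ℤ) : ex ((m : ℂ) / 2) = (-1 : ℂ) ^ m := by
  rw [← ex_half]; unfold ex; rw [← Complex.exp_int_mul]; ring_nf

lemma ex_neg_mul (a : ℂ) : ex (-a) * ex a = 1 := by rw [← ex_add]; simp [ex_zero]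

lemma term_eq_ex (n : ℤ) (z τ : ℂ) : jacobiTheta₂_term n z τ = ex (n * z + n ^ 2 * τ / 2) := by
  unfold jacobiTheta₂_term ex; ring_nf

lemma norm_ex (z : ℂ) : ‖ex z‖ = Real.exp (-(2 * Real.pi * z.im)) := by
  unfold ex; rw [Complex.norm_exp]; simp

lemma differentiable_ex : Differentiable ℂ ex := by unfold ex; fun_prop

lemma theta_eq (τ z : ℂ) :
    theta τ z = ex (τ / 8) * jacobiTheta₂ (z + (τ + 1) / 2) τ := by
  unfold theta jacobiTheta₂
  congr 1
  · unfold ex; ring_nf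
  · congr 1; ext m
    rw [term_eq_ex, show (m : ℂ) * (z + (τ + 1) / 2) + m ^ 2 * τ / 2 =
      (m : ℂ) / 2 + ((m : ℂ) * ((m : ℂ) + 1) * τ / 2 + (m : ℂ) * z) by ring, ex_add, ex_half_int]
    rfl

def thA (τ x : ℂ) : ℂ := jacobiTheta₂ (2 * x) (2 * τ)
def thB (τ x : ℂ) : ℂ := ex (x + τ / 4) * jacobiTheta₂ (2 * x + τ) (2 * τ)

/-- the genuinely odd theta function -/
def th (τ z : ℂ) : ℂ := ex (z / 2) * theta τ z

def splitMap : (ℤ × ℤ) ⊕ (ℤ × ℤ) → ℤ × ℤ :=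
  Sum.elim (fun p => (p.1 + p.2, p.1 - p.2)) (fun p => (p.1 + p.2 + 1, p.1 - p.2))

lemma splitMap_bij : Function.Bijective splitMap := by
  constructor
  · rintro (⟨a, b⟩ | ⟨a, b⟩) (⟨c, d⟩ | ⟨c, d⟩) h <;> simp only [splitMap, Sum.elim_inl, Sum.elim_inr, Prod.mk.injEq] at h
    · obtain ⟨h1, h2⟩ := h
      have : a = c := by omega
      have : b = d := by omega
      subst_vars; rfl
    · omega
    · omega
    · obtain ⟨h1, h2⟩ := h
      have : a = c := by omega
      have : b = d := by omega
      subst_vars; rfl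
  · rintro ⟨m, n⟩
    rcases Int.even_or_odd (m + n) with ⟨r, hr⟩ | ⟨r, hr⟩
    · refine ⟨Sum.inl (r, m - r), ?_⟩
      simp only [splitMap, Sum.elim_inl, Prod.mk.injEq]; omega
    · refine ⟨Sum.inr (r, m - r - 1), ?_⟩
      simp only [splitMap, Sum.elim_inr, Prod.mk.injEq]; omega

lemma summable_J {τ : ℂ} (hτ : 0 < τ.im) (z : ℂ) : Summable (jacobiTheta₂_term · z τ) :=
  (summable_jacobiTheta₂_term_iff z τ).2 hτ

lemma J_mul {τ : ℂ} (hτ : 0 < τ.im) (x y : ℂ) :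
    HasSum (fun p : ℤ × ℤ => jacobiTheta₂_term p.1 x τ * jacobiTheta₂_term p.2 y τ)
      (jacobiTheta₂ x τ * jacobiTheta₂ y τ) := by
  have h1 := (summable_J hτ x).norm
  have h2 := (summable_J hτ y).norm
  have h3 := summable_mul_of_summable_norm (f := fun n => jacobiTheta₂_term n x τ) (g := fun n => jacobiTheta₂_term n y τ) h1 h2
  exact HasSum.mul (f := fun n => jacobiTheta₂_term n x τ) (g := fun n => jacobiTheta₂_term n y τ) (hasSum_jacobiTheta₂_term x hτ) (hasSum_jacobiTheta₂_term y hτ) h3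

lemma two_tau {τ : ℂ} (hτ : 0 < τ.im) : 0 < (2 * τ).im := by simpa using hτ

lemma HasSum.congr_fun' {α : Type*} {f g : α → ℂ} {s : ℂ} (h : HasSum f s) (e : ∀ x, g x = f x) :
    HasSum g s := by
  rw [show g = f from funext e]; exact h

lemma J_prod {τ : ℂ} (hτ : 0 < τ.im) (x y : ℂ) :
    jacobiTheta₂ (x + y) τ * jacobiTheta₂ (x - y) τ
      = thA τ x * thA τ y + thB τ x * thB τ y := by
  have h0 := J_mul hτ (x + y) (x - y)
  have h0' := (Equiv.ofBijective _ splitMap_bij).hasSum_iff.2 h0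
  have h2 := two_tau hτ
  have hA := J_mul h2 (2 * x) (2 * y)
  have hB := (J_mul h2 (2 * x + τ) (2 * y + τ)).mul_left (ex (x + τ / 4) * ex (y + τ / 4))
  have hC : HasSum ((fun p : ℤ × ℤ => jacobiTheta₂_term p.1 (x + y) τ * jacobiTheta₂_term p.2 (x - y) τ) ∘ (Equiv.ofBijective _ splitMap_bij)) (thA τ x * thA τ y + thB τ x * thB τ y) := by
    apply HasSum.sum
    · refine HasSum.congr_fun' hA ?_
      rintro ⟨k, l⟩
      simp only [Function.comp, Equiv.ofBijective_apply, splitMap, Sum.elim_inl, term_eq_ex, ← ex_add]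
      push_cast; ring_nf
    · rw [show thB τ x * thB τ y = ex (x + τ / 4) * ex (y + τ / 4) * (jacobiTheta₂ (2 * x + τ) (2 * τ) * jacobiTheta₂ (2 * y + τ) (2 * τ)) by unfold thB; ring]
      refine HasSum.congr_fun' hB ?_
      rintro ⟨k, l⟩
      simp only [Function.comp, Equiv.ofBijective_apply, splitMap, Sum.elim_inr, term_eq_ex, ← ex_add]
      push_cast; ring_nf
  exact h0'.unique hC

lemma thA_shift {τ : ℂ} (x : ℂ) :
    thA τ (x + (τ + 1) / 2) = ex (-x - τ / 4) * thB τ x := by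
  unfold thA thB
  rw [← mul_assoc, ← ex_add, show -x - τ / 4 + (x + τ / 4) = 0 by ring, ex_zero, one_mul,
    show 2 * (x + (τ + 1) / 2) = (2 * x + τ) + 1 by ring, jacobiTheta₂_add_left]

lemma thB_shift {τ : ℂ} (x : ℂ) :
    thB τ (x + (τ + 1) / 2) = - ex (-x - τ / 4) * thA τ x := by
  unfold thA thB
  rw [show 2 * (x + (τ + 1) / 2) + τ = (2 * x + 2 * τ) + 1 by ring, jacobiTheta₂_add_left,
    jacobiTheta₂_add_left', ← mul_assoc]
  congr 1
  rw [show Complex.exp (-↑Real.pi * Complex.I * (2 * τ + 2 * (2 * x))) = ex (- τ - x - x) by unfold ex; ring_nf,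
    ← ex_add, show x + (τ + 1) / 2 + τ / 4 + (-τ - x - x) = 1/2 + (-x - τ/4)  by ring, ex_add, ex_half]
  ring

lemma th_prod {τ : ℂ} (hτ : 0 < τ.im) (x y : ℂ) :
    th τ (x + y) * th τ (x - y) = thB τ x * thA τ y - thA τ x * thB τ y := by
  have h := J_prod hτ (x + (τ + 1) / 2) y
  rw [thA_shift, thB_shift] at h
  unfold th
  rw [theta_eq, theta_eq, show x + y + (τ + 1) / 2 = x + (τ + 1) / 2 + y by ring,
    show x - y + (τ + 1) / 2 = x + (τ + 1) / 2 - y by ring]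
  calc _ = (ex ((x + y) / 2) * ex ((x - y) / 2) * ex (τ / 8) * ex (τ / 8)) *
        (jacobiTheta₂ (x + (τ + 1) / 2 + y) τ * jacobiTheta₂ (x + (τ + 1) / 2 - y) τ) := by ring
    _ = (ex ((x + y) / 2) * ex ((x - y) / 2) * ex (τ / 8) * ex (τ / 8) * ex (-x - τ / 4)) *
        (thB τ x * thA τ y - thA τ x * thB τ y) := by rw [h]; ring
    _ = _ := by
      simp only [← ex_add]
      rw [show (x + y) / 2 + (x - y) / 2 + τ / 8 + τ / 8 + (-x - τ / 4) = 0 by ring, ex_zero, one_mul]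

lemma th_add_one (τ z : ℂ) : th τ (z + 1) = - th τ z := by
  unfold th
  rw [theta_eq, theta_eq, show z + 1 + (τ + 1) / 2 = z + (τ + 1) / 2 + 1 by ring,
    jacobiTheta₂_add_left, show (z + 1) / 2 = z / 2 + 1 / 2 by ring, ex_add, ex_half]
  ring

lemma th_add_tau (τ z : ℂ) : th τ (z + τ) = - ex (-z - τ / 2) * th τ z := by
  unfold th
  rw [theta_eq, theta_eq, show z + τ + (τ + 1) / 2 = z + (τ + 1) / 2 + τ by ring,
    jacobiTheta₂_add_left',
    show Complex.exp (-↑Real.pi * Complex.I * (τ + 2 * (z + (τ + 1) / 2))) = ex (- τ - z - 1 / 2) by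
      unfold ex; ring_nf]
  have h1 : ex ((z + τ) / 2) * ex (- τ - z - 1/2) = - ex (-z - τ/2) * ex (z/2) := by
    have : -ex (-z - τ/2) = ex (1/2) * ex (-z - τ/2) := by rw [ex_half]; ring
    rw [this, ← ex_add, ← ex_add, ← ex_add, show (z + τ) / 2 + (- τ - z - 1/2) = (1/2 + (-z - τ/2) + z/2) + ((-1 : ℤ) : ℂ) by push_cast; ring,
      ex_add _ ((-1 : ℤ) : ℂ), ex_int, mul_one]
  linear_combination (ex (τ/8) * jacobiTheta₂ (z + (τ + 1) / 2) τ) * h1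

lemma th_neg (τ z : ℂ) : th τ (-z) = - th τ z := by
  unfold th
  rw [theta_eq, theta_eq, ← jacobiTheta₂_neg_left, show -(-z + (τ + 1) / 2) = (z + (τ + 1)/2) - 1 - τ by ring]
  have h1 := jacobiTheta₂_add_left' ((z + (τ + 1)/2) - 1 - τ) τ
  have h2 := jacobiTheta₂_add_left ((z + (τ + 1)/2) - 1) τ
  rw [show z + (τ + 1) / 2 - 1 - τ + τ = z + (τ + 1) / 2 - 1 by ring] at h1
  rw [show z + (τ + 1) / 2 - 1 + 1 = z + (τ + 1) / 2  by ring] at h2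
  rw [h2, h1,
    show Complex.exp (-↑Real.pi * Complex.I * (τ + 2 * (z + (τ + 1) / 2 - 1 - τ))) = ex (-z + 1/2) by
      unfold ex; ring_nf, ex_add, ex_half]
  have : ex (-z/2) = ex (z/2) * ex (-z) := by rw [← ex_add]; ring_nf
  rw [this]; ring

lemma th_zero (τ : ℂ) : th τ 0 = 0 := by
  have := th_neg τ 0
  rw [neg_zero] at this
  exact self_eq_neg.1 this

lemma differentiable_J {τ : ℂ} (hτ : 0 < τ.im) : Differentiable ℂ (fun z => jacobiTheta₂ z τ) :=
  fun z => differentiableAt_jacobiTheta₂_fst z hτ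

lemma differentiable_theta {τ : ℂ} (hτ : 0 < τ.im) : Differentiable ℂ (theta τ) := by
  have : theta τ = fun z => ex (τ / 8) * jacobiTheta₂ (z + (τ + 1) / 2) τ := funext (theta_eq τ)
  rw [this]
  exact ((differentiable_J hτ).comp (by fun_prop : Differentiable ℂ fun z : ℂ => z + (τ+1)/2)).const_mul _

lemma differentiable_th {τ : ℂ} (hτ : 0 < τ.im) : Differentiable ℂ (th τ) := by
  unfold th
  exact (differentiable_ex.comp (by fun_prop : Differentiable ℂ fun z : ℂ => z / 2)).mul (differentiable_theta hτ)

lemma differentiable_thA {τ : ℂ} (hτ : 0 < τ.im) : Differentiable ℂ (thA τ) := by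
  unfold thA
  exact (differentiable_J (two_tau hτ)).comp (by fun_prop : Differentiable ℂ fun z : ℂ => 2 * z)

lemma differentiable_thB {τ : ℂ} (hτ : 0 < τ.im) : Differentiable ℂ (thB τ) := by
  unfold thB
  exact (differentiable_ex.comp (by fun_prop : Differentiable ℂ fun z : ℂ => z + τ / 4)).mul
    ((differentiable_J (two_tau hτ)).comp (by fun_prop : Differentiable ℂ fun z : ℂ => 2 * z + τ))

lemma J_ne_zero {τ : ℂ} (hτ : 0 < τ.im) : ∃ z, jacobiTheta₂ z τ ≠ 0 := by
  by_contra! h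
  have hs : HasSum (fun n : ℤ => ∫ x in (0:ℝ)..1, jacobiTheta₂_term n (x : ℂ) τ)
      (∫ x in (0:ℝ)..1, ∑' n : ℤ, jacobiTheta₂_term n (x : ℂ) τ) := by
    have hc : ∀ n : ℤ, Continuous fun x : ℝ => jacobiTheta₂_term n (x : ℂ) τ := by
      intro n; unfold jacobiTheta₂_term; fun_prop
    refine intervalIntegral.hasSum_intervalIntegral_of_summable_norm (f := fun n => ⟨fun x : ℝ => jacobiTheta₂_term n (x : ℂ) τ, hc n⟩) ?_
    refine Summable.of_nonneg_of_le (fun _ => norm_nonneg _) ?_ (summable_J hτ 0).norm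
    intro n
    rw [ContinuousMap.norm_le _ (norm_nonneg _)]
    rintro ⟨x, hx⟩
    simp [norm_jacobiTheta₂_term]
  have hz : (∫ x in (0:ℝ)..1, ∑' n : ℤ, jacobiTheta₂_term n (x : ℂ) τ) = 0 := by
    have : ∀ x : ℝ, ∑' n : ℤ, jacobiTheta₂_term n (x : ℂ) τ = 0 := fun x => h x
    simp [this]
  have hn : ∀ n : ℤ, n ≠ 0 → (∫ x in (0:ℝ)..1, jacobiTheta₂_term n (x : ℂ) τ) = 0 := by
    intro n hn
    have : ∀ x : ℝ, jacobiTheta₂_term n (x : ℂ) τ = Complex.exp ((2 * (Real.pi : ℂ) * Complex.I * n) * x) * ex (n^2 * τ / 2) := by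
      intro x; rw [term_eq_ex, ex_add]; unfold ex; ring_nf
    simp_rw [this]
    rw [intervalIntegral.integral_mul_const, integral_exp_mul_complex]
    · have := ex_int n
      unfold ex at this
      simp [this]
    · have := Complex.two_pi_I_ne_zero
      simp [hn]
  have h2 := hasSum_single (f := fun n : ℤ => ∫ x in (0:ℝ)..1, jacobiTheta₂_term n (x : ℂ) τ) 0 hn
  have h3 := hs.unique h2
  rw [hz] at h3
  simp [jacobiTheta₂_term] at h3

lemma th_ne_zero {τ : ℂ} (hτ : 0 < τ.im) : ∃ z, th τ z ≠ 0 := by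
  obtain ⟨z, hz⟩ := J_ne_zero hτ
  refine ⟨z - (τ + 1) / 2, ?_⟩
  unfold th
  rw [theta_eq, sub_add_cancel]
  exact mul_ne_zero (ex_ne _) (mul_ne_zero (ex_ne _) hz)

/-- Fay identity in theta form -/
lemma th_fay {τ : ℂ} (hτ : 0 < τ.im) (u₁ u₂ x₁ x₂ : ℂ) :
    th τ (u₁ + x₁) * th τ (u₂ + x₂) * th τ (x₁ - x₂) * th τ (u₁ + u₂) =
      th τ (u₁ + (x₁ - x₂)) * th τ (u₁ + u₂ + x₂) * th τ u₂ * th τ x₁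
      - th τ (u₂ + (x₂ - x₁)) * th τ (u₁ + u₂ + x₁) * th τ u₁ * th τ x₂ := by
  set a := (u₁ + u₂ + x₁ + x₂) / 2 with ha
  set b := (u₁ - u₂ + x₁ - x₂) / 2 with hb
  set c := (u₁ + u₂ + x₁ - x₂) / 2 with hc
  set d := (u₁ + u₂ - x₁ + x₂) / 2 with hd
  have hab := th_prod hτ a b
  have hcd := th_prod hτ c d
  have hac := th_prod hτ a c
  have hbd := th_prod hτ b d
  have had := th_prod hτ a d
  have hbc := th_prod hτ b c
  rw [show a + b = u₁ + x₁ by rw [ha, hb]; ring, show a - b = u₂ + x₂ by rw [ha, hb]; ring] at hab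
  rw [show c + d = u₁ + u₂ by rw [hc, hd]; ring, show c - d = x₁ - x₂ by rw [hc, hd]; ring] at hcd
  rw [show a + c = u₁ + u₂ + x₁ by rw [ha, hc]; ring, show a - c = x₂ by rw [ha, hc]; ring] at hac
  rw [show b + d = u₁ by rw [hb, hd]; ring, show b - d = -(u₂ + (x₂ - x₁)) by rw [hb, hd]; ring, th_neg] at hbd
  rw [show a + d = u₁ + u₂ + x₂ by rw [ha, hd]; ring, show a - d = x₁ by rw [ha, hd]; ring] at had
  rw [show b + c = u₁ + (x₁ - x₂) by rw [hb, hc]; ring, show b - c = -u₂ by rw [hb, hc]; ring, th_neg] at hbc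
  clear_value a b c d
  generalize thA τ a = Aa at *
  generalize thA τ b = Ab at *
  generalize thA τ c = Ac at *
  generalize thA τ d = Ad at *
  generalize thB τ a = Ba at *
  generalize thB τ b = Bb at *
  generalize thB τ c = Bc at *
  generalize thB τ d = Bd at *
  have e1 : th τ (u₁ + x₁) * th τ (u₂ + x₂) * th τ (x₁ - x₂) * th τ (u₁ + u₂) =
    (Ba * Ab - Aa * Bb) * (Bc * Ad - Ac * Bd) := by rw [← hab, ← hcd]; ring
  have e2 : th τ (u₁ + (x₁ - x₂)) * th τ (u₁ + u₂ + x₂) * th τ u₂ * th τ x₁ =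
    - ((Ba * Ad - Aa * Bd) * (Bb * Ac - Ab * Bc)) := by rw [← had, ← hbc]; ring
  have e3 : th τ (u₂ + (x₂ - x₁)) * th τ (u₁ + u₂ + x₁) * th τ u₁ * th τ x₂ =
    - ((Ba * Ac - Aa * Bc) * (Bb * Ad - Ab * Bd)) := by rw [← hac, ← hbd]; ring
  rw [e1, e2, e3]; ring
/-! ### Zeros of the theta function -/

lemma exists_quot {f g : ℂ → ℂ} (hf : Differentiable ℂ f) (hg : Differentiable ℂ g)
    (hfin : ∀ z, analyticOrderAt g z ≠ ⊤)
    (h : ∀ z, analyticOrderAt f z = analyticOrderAt g z) :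
    ∃ G : ℂ → ℂ, Differentiable ℂ G ∧ (∀ z, G z ≠ 0) ∧ ∀ z, f z = G z * g z := by
  have hmf : ∀ z, MeromorphicAt f z := fun z => (hf.analyticAt z).meromorphicAt
  have hmg : ∀ z, MeromorphicAt g z := fun z => (hg.analyticAt z).meromorphicAt
  have hm : MeromorphicOn (f * g⁻¹) Set.univ := fun z _ => (hmf z).mul (hmg z).inv
  have hord : ∀ z, meromorphicOrderAt (f * g⁻¹) z = 0 := by
    intro z
    rw [meromorphicOrderAt_mul (hmf z) (hmg z).inv, meromorphicOrderAt_inv,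
      (hf.analyticAt z).meromorphicOrderAt_eq, (hg.analyticAt z).meromorphicOrderAt_eq, h z]
    obtain ⟨m, hm⟩ := ENat.ne_top_iff_exists.1 (hfin z)
    rw [← hm]
    show ((m : ℤ) : WithTop ℤ) + -((m : ℤ) : WithTop ℤ) = 0
    rw [← WithTop.LinearOrderedAddCommGroup.coe_neg, ← WithTop.coe_add]; simp
  set G := toMeromorphicNFOn (f * g⁻¹) Set.univ with hG
  have hnf : ∀ z, MeromorphicNFAt G z := fun z => meromorphicNFOn_toMeromorphicNFOn _ _ (Set.mem_univ z)
  have hGord : ∀ z, meromorphicOrderAt G z = 0 := fun z => by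
    rw [hG, meromorphicOrderAt_toMeromorphicNFOn hm (Set.mem_univ z), hord]
  have hGa : ∀ z, AnalyticAt ℂ G z := fun z =>
    (hnf z).meromorphicOrderAt_nonneg_iff_analyticAt.1 (hGord z).ge
  refine ⟨G, fun z => (hGa z).differentiableAt, fun z => (hnf z).meromorphicOrderAt_eq_zero_iff.1 (hGord z), ?_⟩
  intro z
  have h1 : G =ᶠ[nhdsWithin z {z}ᶜ] f * g⁻¹ := hm.toMeromorphicNFOn_eq_self_on_nhdsNE (Set.mem_univ z)
  have h2 : ∀ᶠ y in nhdsWithin z {z}ᶜ, g y ≠ 0 := by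
    rcases (hg.analyticAt z).eventually_eq_zero_or_eventually_ne_zero with h | h
    · exact absurd (analyticOrderAt_eq_top.2 h) (hfin z)
    · exact h
  have h3 : f =ᶠ[nhdsWithin z {z}ᶜ] fun y => G y * g y := by
    filter_upwards [h1, h2] with y e1 e2
    rw [e1]; simp [e2]
  have h4 : Filter.Tendsto f (nhdsWithin z {z}ᶜ) (nhds (f z)) := (hf z).continuousAt.mono_left nhdsWithin_le_nhds
  have h5 : Filter.Tendsto (fun y => G y * g y) (nhdsWithin z {z}ᶜ) (nhds (G z * g z)) :=
    ((hGa z).continuousAt.mul (hg z).continuousAt).mono_left nhdsWithin_le_nhds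
  exact tendsto_nhds_unique h4 (h5.congr' h3.symm)

lemma th_order_ne_top {τ : ℂ} (hτ : 0 < τ.im) (z : ℂ) : analyticOrderAt (th τ) z ≠ ⊤ := by
  obtain ⟨w, hw⟩ := th_ne_zero hτ
  intro h
  have ha : AnalyticOnNhd ℂ (th τ) Set.univ := fun z _ => (differentiable_th hτ).analyticAt z
  have := ha.eq_of_eventuallyEq (g := fun _ => 0) (fun z _ => analyticAt_const) (analyticOrderAt_eq_top.1 h)
  exact hw (congrFun this w)

lemma order_shift {f : ℂ → ℂ} (u z : ℂ) :
    analyticOrderAt (fun y => f (y + u)) z = analyticOrderAt f (z + u) := by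
  have h1 : AnalyticAt ℂ (fun y : ℂ => y + u) z := by fun_prop
  have := analyticOrderAt_comp_of_deriv_ne_zero (f := f) h1 (by simp)
  simpa [Function.comp_def] using this

lemma affine_const (f : ℤ → ℕ) (h : ∀ k, f (k + 1) + f (k - 1) = 2 * f k) : f 1 = f 0 := by
  have h1 : ∀ k : ℕ, (f k : ℤ) = f 0 + k * (f 1 - f 0) ∧ (f (k + 1) : ℤ) = f 0 + (k + 1) * (f 1 - f 0) := by
    intro k
    induction k with
    | zero => simp
    | succ k ih =>
      refine ⟨by push_cast; exact ih.2, ?_⟩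
      have := h (k + 1)
      rw [add_sub_cancel_right] at this
      have e : (f ((k : ℤ) + 1 + 1) : ℤ) + f k = 2 * f (k + 1) := by exact_mod_cast this
      push_cast
      linarith [ih.1, ih.2]
  have h2 : ∀ k : ℕ, (f (-k) : ℤ) = f 0 - k * (f 1 - f 0) ∧ (f (-k + 1) : ℤ) = f 0 - (k - 1) * (f 1 - f 0) := by
    intro k
    induction k with
    | zero => simp
    | succ k ih =>
      have := h (-k)
      have e : (f (-(k : ℤ) + 1) : ℤ) + f (-k - 1) = 2 * f (-k) := by exact_mod_cast this
      have e1 : (-((k + 1 : ℕ) : ℤ)) = -k - 1 := by push_cast; ring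
      rw [e1, sub_add_cancel]
      push_cast
      constructor <;> linarith [ih.1, ih.2]
  by_contra hne
  rcases lt_or_gt_of_ne hne with hlt | hgt
  · have := (h1 (f 0 + 1)).1
    have h0 : (0 : ℤ) ≤ f ((f 0 + 1 : ℕ) : ℤ) := by positivity
    rw [this] at h0
    push_cast at h0
    have : (f 1 : ℤ) - f 0 ≤ -1 := by omega
    nlinarith
  · have := (h2 (f 0 + 1)).1
    have h0 : (0 : ℤ) ≤ f (-((f 0 + 1 : ℕ) : ℤ)) := by positivity
    rw [this] at h0
    push_cast at h0
    have : (1 : ℤ) ≤ (f 1 : ℤ) - f 0 := by omega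
    nlinarith

lemma AB_zero_ne {τ : ℂ} (hτ : 0 < τ.im) : thA τ 0 ≠ 0 ∨ thB τ 0 ≠ 0 := by
  by_contra! h
  obtain ⟨w, hw⟩ := th_ne_zero hτ
  have := th_prod hτ w 0
  rw [h.1, h.2] at this
  simp at this
  exact hw this

lemma th_quot_of_zero {τ : ℂ} (hτ : 0 < τ.im) {u : ℂ} (hu : th τ u = 0) :
    ∃ lam : ℂ, ∀ z, th τ (z + u) * th τ (z - u) = lam * (th τ z * th τ z) := by
  have h0 := th_prod hτ u 0
  rw [add_zero, sub_zero, hu] at h0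
  have hz : ∀ z, th τ z * th τ z = thB τ z * thA τ 0 - thA τ z * thB τ 0 := by
    intro z; have := th_prod hτ z 0; rwa [add_zero, sub_zero] at this
  simp_rw [th_prod hτ _ u, hz]
  rcases AB_zero_ne hτ with h | h
  · refine ⟨thA τ u / thA τ 0, fun z => ?_⟩
    field_simp
    linear_combination (thA τ z) * h0
  · refine ⟨thB τ u / thB τ 0, fun z => ?_⟩
    field_simp
    linear_combination (thB τ z) * h0

lemma th_order_eq {τ : ℂ} (hτ : 0 < τ.im) {u : ℂ} (hu : th τ u = 0) (z : ℂ) :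
    analyticOrderAt (th τ) (z + u) = analyticOrderAt (th τ) z := by
  obtain ⟨lam, hl⟩ := th_quot_of_zero hτ hu
  have han : ∀ v z : ℂ, AnalyticAt ℂ (fun y => th τ (y + v)) z := fun v z => by
    have : Differentiable ℂ (fun y => th τ (y + v)) := (differentiable_th hτ).comp (by fun_prop)
    exact this.analyticAt z
  have hT := (differentiable_th hτ).analyticAt
  have key : ∀ z, analyticOrderAt (th τ) (z + u) + analyticOrderAt (th τ) (z - u)
      = analyticOrderAt (th τ) z + analyticOrderAt (th τ) z := by
    intro z
    have e1 := analyticOrderAt_mul (han u z) (han (-u) z)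
    rw [order_shift, order_shift, ← sub_eq_add_neg] at e1
    rw [← e1]
    have e2 : (fun y => th τ (y + u)) * (fun y => th τ (y + -u)) = (fun _ => lam) * (th τ * th τ) := by
      ext y; simpa [sub_eq_add_neg] using hl y
    have hlam : lam ≠ 0 := by
      rintro rfl
      have e3 : analyticOrderAt ((fun y => th τ (y + u)) * (fun y => th τ (y + -u))) z = ⊤ := by
        rw [e2, analyticOrderAt_eq_top]; simp
      rw [e3] at e1
      rcases WithTop.add_eq_top.1 e1.symm with e | e
      · exact th_order_ne_top hτ _ e
      · exact th_order_ne_top hτ _ e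
    rw [e2, analyticOrderAt_mul analyticAt_const ((hT z).mul (hT z)), analyticOrderAt_mul (hT z) (hT z)]
    rw [analyticOrderAt_eq_zero.2 (Or.inr hlam), zero_add]
  set o : ℂ → ℕ := fun z => (analyticOrderAt (th τ) z).toNat with ho
  have hoc : ∀ z, analyticOrderAt (th τ) z = o z := fun z => (ENat.natCast_toNat (th_order_ne_top hτ z)).symm
  have key2 : ∀ z, o (z + u) + o (z - u) = 2 * o z := by
    intro z
    have := key z
    rw [hoc, hoc, hoc] at this
    rw [two_mul]; exact_mod_cast this
  have := affine_const (fun k : ℤ => o (z + k * u)) (by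
    intro k
    have := key2 (z + k * u)
    push_cast
    rw [show z + ((k : ℂ) + 1) * u = z + k * u + u by ring, show z + ((k : ℂ) - 1) * u = z + k * u - u by ring]
    exact this)
  simp at this
  rw [hoc, hoc, this]

lemma periodic_bounded {τ : ℂ} (hτ : 0 < τ.im) {f : ℂ → ℂ} (hf : Continuous f)
    (h1 : ∀ z, ‖f (z + 1)‖ = ‖f z‖) (h2 : ∀ z, ‖f (z + τ)‖ = ‖f z‖) :
    ∃ C, ∀ z, ‖f z‖ ≤ C := by
  have g1 : ∀ (m : ℤ) z, ‖f (z + m)‖ = ‖f z‖ := by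
    intro m
    induction m using Int.induction_on with
    | zero => simp
    | succ m ih => intro z; push_cast; rw [← add_assoc, h1, ← ih z]; simp
    | pred m ih => intro z; rw [← ih z, ← h1 (z + _)]; push_cast; ring_nf
  have g2 : ∀ (m : ℤ) z, ‖f (z + m * τ)‖ = ‖f z‖ := by
    intro m
    induction m using Int.induction_on with
    | zero => simp
    | succ m ih => intro z; push_cast; rw [add_mul, one_mul, ← add_assoc, h2, ← ih z]; simp
    | pred m ih => intro z; rw [← ih z, ← h2 (z + _)]; push_cast; ring_nf
  have hK : IsCompact (Set.Icc (0:ℝ) 1 ×ˢ Set.Icc (0:ℝ) 1) := isCompact_Icc.prod isCompact_Icc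
  obtain ⟨C, hC⟩ := hK.exists_bound_of_continuousOn (f := fun p : ℝ × ℝ => f (p.1 + p.2 * τ)) (by fun_prop)
  refine ⟨C, fun z => ?_⟩
  set y : ℝ := z.im / τ.im with hy
  set x : ℝ := z.re - y * τ.re with hx
  have hz : z = x + y * τ := by
    apply Complex.ext
    · simp [hx]
    · simp [hy]; field_simp
  have e : z = (((Int.fract x : ℝ) : ℂ) + (Int.fract y : ℝ) * τ + (⌊x⌋ : ℤ)) + (⌊y⌋ : ℤ) * τ := by
    have ex1 : (x : ℂ) = ((Int.fract x : ℝ) : ℂ) + (⌊x⌋ : ℤ) := by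
      conv_lhs => rw [← Int.fract_add_floor x]
      push_cast; rfl
    have ey1 : (y : ℂ) = ((Int.fract y : ℝ) : ℂ) + (⌊y⌋ : ℤ) := by
      conv_lhs => rw [← Int.fract_add_floor y]
      push_cast; rfl
    rw [hz, ex1, ey1]; ring
  rw [e, g2, g1]
  exact hC (Int.fract x, Int.fract y) ⟨⟨Int.fract_nonneg x, (Int.fract_lt_one x).le⟩, ⟨Int.fract_nonneg y, (Int.fract_lt_one y).le⟩⟩

lemma th_zero_mem {τ : ℂ} (hτ : 0 < τ.im) {u : ℂ} (hu : th τ u = 0) : u ∈ latticeGamma τ := by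
  have hT := differentiable_th hτ
  have hTu : Differentiable ℂ (fun y => th τ (y + u)) := hT.comp (by fun_prop)
  obtain ⟨G, hG, hG0, hGe⟩ := exists_quot hTu hT (th_order_ne_top hτ)
    (fun z => by rw [order_shift, th_order_eq hτ hu])
  have hdense : ∀ F H : ℂ → ℂ, Continuous F → Continuous H → (∀ z, F z * th τ z = H z * th τ z) → ∀ z, F z = H z := by
    intro F H hF hH hFH z
    have h2 : ∀ᶠ y in nhdsWithin z {z}ᶜ, th τ y ≠ 0 := by
      rcases (hT.analyticAt z).eventually_eq_zero_or_eventually_ne_zero with h | h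
      · exact absurd (analyticOrderAt_eq_top.2 h) (th_order_ne_top hτ z)
      · exact h
    have h3 : F =ᶠ[nhdsWithin z {z}ᶜ] H := by
      filter_upwards [h2] with y hy
      exact mul_right_cancel₀ hy (hFH y)
    exact tendsto_nhds_unique (hF.continuousAt.mono_left nhdsWithin_le_nhds)
      ((hH.continuousAt.mono_left nhdsWithin_le_nhds).congr' h3.symm)
  have hG1 : ∀ z, G (z + 1) = G z := by
    apply hdense (fun z => G (z + 1)) G (hG.continuous.comp (by fun_prop)) hG.continuous
    intro z
    have e := hGe (z + 1)
    rw [show z + 1 + u = z + u + 1 by ring, th_add_one, th_add_one] at e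
    rw [← hGe z]
    linear_combination e
  have hG2 : ∀ z, G (z + τ) = ex (-u) * G z := by
    apply hdense (fun z => G (z + τ)) (fun z => ex (-u) * G z) (hG.continuous.comp (by fun_prop)) (by have := hG.continuous; fun_prop)
    intro z
    have e := hGe (z + τ)
    rw [show z + τ + u = z + u + τ by ring, th_add_tau, th_add_tau, show -(z + u) - τ / 2 = -u + (-z - τ/2) by ring,
      ex_add, hGe z] at e
    have := ex_ne (-z - τ/2)
    apply mul_left_cancel₀ this
    linear_combination e
  set α : ℝ := u.im / τ.im with hα
  have hbd := periodic_bounded hτ (f := fun z => G z * ex (α * z))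
    (hG.continuous.mul (differentiable_ex.continuous.comp (by fun_prop)))
    (by
      intro z
      simp only [norm_mul, hG1, norm_ex]
      congr 3; simp)
    (by
      intro z
      simp only [norm_mul, hG2, norm_ex]
      rw [mul_assoc, mul_comm ‖G z‖, ← mul_assoc, ← Real.exp_add, mul_comm _ ‖G z‖]
      congr 2
      simp [hα]; field_simp; ring)
  obtain ⟨C, hC⟩ := hbd
  have hd : Differentiable ℂ (fun z => G z * ex (α * z)) :=
    hG.mul (differentiable_ex.comp (by fun_prop : Differentiable ℂ fun z : ℂ => (α : ℂ) * z))
  have hconst := hd.apply_eq_apply_of_bounded (isBounded_iff_forall_norm_le.2 ⟨C, by rintro _ ⟨z, rfl⟩; exact hC z⟩)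
  have c1 := hconst (0 + 1) 0
  have c2 := hconst (0 + τ) 0
  simp only [hG1, hG2] at c1 c2
  simp only [zero_add, mul_zero, ex_zero, mul_one] at c1 c2
  have d1 : ex α = 1 := mul_left_cancel₀ (hG0 0) (by rw [c1, mul_one])
  have d2 : ex (-u + α * τ) = 1 := mul_left_cancel₀ (hG0 0) (by rw [ex_add, mul_one]; linear_combination c2)
  obtain ⟨n, hn⟩ := ex_eq_one d1
  obtain ⟨m, hm⟩ := ex_eq_one d2
  refine ⟨-m, n, ?_⟩
  rw [hn] at hm
  push_cast
  linear_combination -hm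

lemma th_deriv_zero {τ : ℂ} (hτ : 0 < τ.im) : deriv (th τ) 0 ≠ 0 := by
  intro h0
  have hT := differentiable_th hτ
  have hA := differentiable_thA hτ
  have hB := differentiable_thB hτ
  have hT0 : HasDerivAt (th τ) 0 0 := by have := (hT 0).hasDerivAt; rwa [h0] at this
  have hW : ∀ y, deriv (thB τ) y * thA τ y - deriv (thA τ) y * thB τ y = 0 := by
    intro y
    have e1 : HasDerivAt (fun x => thB τ x * thA τ y - thA τ x * thB τ y)
      (deriv (thB τ) y * thA τ y - deriv (thA τ) y * thB τ y) y :=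
      ((hB y).hasDerivAt.mul_const _).sub ((hA y).hasDerivAt.mul_const _)
    have e2 : HasDerivAt (fun x => th τ (x + y) * th τ (x - y)) 0 y := by
      have f1 : HasDerivAt (fun x => th τ (x + y)) (deriv (th τ) (y + y)) y :=
        (hT (y + y)).hasDerivAt.comp_add_const y y
      have f2 : HasDerivAt (fun x => th τ (x - y)) 0 y := by
        have : HasDerivAt (th τ) 0 (y - y) := by rwa [sub_self]
        exact this.comp_sub_const y y
      have := f1.mul f2
      rw [sub_self, th_zero] at this
      simp only [mul_zero, add_zero] at this
      exact this
    simp_rw [th_prod hτ] at e2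
    exact e1.unique e2
  have hex : ∃ y, thA τ y ≠ 0 := by
    by_contra! hc
    obtain ⟨w, hw⟩ := th_ne_zero hτ
    have := th_prod hτ w 0
    rw [hc, hc] at this
    simp at this
    exact hw this
  obtain ⟨y, hy⟩ := hex
  have hev : ∀ᶠ x in nhds y, thA τ x ≠ 0 := hA.continuous.continuousAt.eventually_ne hy
  obtain ⟨r, hr, hball⟩ := Metric.eventually_nhds_iff_ball.1 hev
  have hq : ∀ x ∈ Metric.ball y r, HasDerivAt (fun x => thB τ x / thA τ x) 0 x := by
    intro x hx
    have := (hB x).hasDerivAt.div (hA x).hasDerivAt (hball x hx)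
    rw [mul_comm (thB τ x), hW x, zero_div] at this
    exact this
  have hc : ∀ x ∈ Metric.ball y r, thB τ x / thA τ x = thB τ y / thA τ y := by
    intro x hx
    refine (convex_ball y r).is_const_of_fderivWithin_eq_zero (𝕜 := ℂ) (f := fun x => thB τ x / thA τ x)
      (fun x hx => (hq x hx).differentiableAt.differentiableWithinAt) ?_ hx (Metric.mem_ball_self hr)
    intro x hx
    rw [fderivWithin_of_isOpen Metric.isOpen_ball hx]
    ext; simp [(hq x hx).deriv]
  have hz : ∀ᶠ x in nhds y, th τ (x + y) * th τ (x + -y) = 0 := by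
    filter_upwards [Metric.ball_mem_nhds y hr] with x hx
    rw [← sub_eq_add_neg, th_prod hτ]
    have h1 := hball x hx
    have := hc x hx
    field_simp at this
    rw [this]; ring
  have han : ∀ v z : ℂ, AnalyticAt ℂ (fun y => th τ (y + v)) z := fun v z => by
    have : Differentiable ℂ (fun y => th τ (y + v)) := (differentiable_th hτ).comp (by fun_prop)
    exact this.analyticAt z
  have e1 := analyticOrderAt_mul (han y y) (han (-y) y)
  have hz' : analyticOrderAt ((fun x => th τ (x + y)) * fun x => th τ (x + -y)) y = ⊤ := analyticOrderAt_eq_top.2 hz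
  rw [order_shift, order_shift, hz'] at e1
  rcases WithTop.add_eq_top.1 e1.symm with e | e
  · exact th_order_ne_top hτ _ e
  · exact th_order_ne_top hτ _ e

lemma theta_ne {τ : ℂ} (hτ : 0 < τ.im) {u : ℂ} (hu : u ∉ latticeGamma τ) : th τ u ≠ 0 :=
  fun h => hu (th_zero_mem hτ h)

lemma deriv_theta_zero {τ : ℂ} (hτ : 0 < τ.im) : deriv (theta τ) 0 = deriv (th τ) 0 := by
  have h1 : theta τ 0 = 0 := by
    have := th_zero τ
    unfold th at this
    simpa [ex_zero] using this
  have hd : HasDerivAt (fun z : ℂ => ex (z / 2)) (deriv (fun z : ℂ => ex (z / 2)) 0) 0 := by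
    apply DifferentiableAt.hasDerivAt
    exact (differentiable_ex.comp (by fun_prop : Differentiable ℂ fun z : ℂ => z / 2)) 0
  have h2 := hd.mul (differentiable_theta hτ 0).hasDerivAt
  have h3 : deriv (th τ) 0 = _ := h2.deriv
  rw [h3, h1]; simp [ex_zero]
/-! ### Kronecker function -/

lemma eN_eq (N : ℕ) (z : ℂ) : eN N z = ex (z / N) := by unfold eN ex; ring_nf

lemma eN_add (N : ℕ) (a b : ℂ) : eN N (a + b) = eN N a * eN N b := by
  rw [eN_eq, eN_eq, eN_eq, ← ex_add]; ring_nf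

lemma eN_ne (N : ℕ) (a : ℂ) : eN N a ≠ 0 := by rw [eN_eq]; exact ex_ne _

lemma eN_zero (N : ℕ) : eN N 0 = 1 := by rw [eN_eq, zero_div, ex_zero]

lemma eN_mul_int {N : ℕ} (hN : N ≠ 0) (m : ℤ) : eN N (N * m) = 1 := by
  have : (N : ℂ) ≠ 0 := by exact_mod_cast hN
  rw [eN_eq, mul_div_cancel_left₀ _ this, ex_int]

lemma theta_eq_th (τ z : ℂ) : theta τ z = ex (-(z / 2)) * th τ z := by
  unfold th; rw [← mul_assoc, ex_neg_mul, one_mul]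

lemma kronPhi_eq {τ : ℂ} (hτ : 0 < τ.im) (u z : ℂ) :
    kronPhi τ u z = th τ (u + z) * deriv (th τ) 0 / (th τ u * th τ z) := by
  unfold kronPhi
  rw [deriv_theta_zero hτ, theta_eq_th, theta_eq_th, theta_eq_th, show -((u + z) / 2) = -(u/2) + -(z/2) by ring, ex_add]
  have h1 := ex_ne (-(u/2))
  have h2 := ex_ne (-(z/2))
  rw [show ex (-(u / 2)) * th τ u * (ex (-(z / 2)) * th τ z) = (ex (-(u / 2)) * ex (-(z / 2))) * (th τ u * th τ z) by ring,
    show ex (-(u / 2)) * ex (-(z / 2)) * th τ (u + z) * deriv (th τ) 0 = (ex (-(u / 2)) * ex (-(z / 2))) * (th τ (u + z) * deriv (th τ) 0) by ring,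
    mul_div_mul_left _ _ (mul_ne_zero h1 h2)]

lemma kronPhi_add_one {τ : ℂ} (hτ : 0 < τ.im) (u z : ℂ) : kronPhi τ (u + 1) z = kronPhi τ u z := by
  rw [kronPhi_eq hτ, kronPhi_eq hτ, show u + 1 + z = u + z + 1 by ring, th_add_one, th_add_one, neg_mul, neg_mul, neg_div_neg_eq]

lemma kronPhi_add_tau {τ : ℂ} (hτ : 0 < τ.im) (u z : ℂ) :
    kronPhi τ (u + τ) z = ex (-z) * kronPhi τ u z := by
  rw [kronPhi_eq hτ, kronPhi_eq hτ, show u + τ + z = u + z + τ by ring, th_add_tau, th_add_tau,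
    show -(u + z) - τ / 2 = -z + (-u - τ/2) by ring, ex_add]
  have h := ex_ne (-u - τ / 2)
  rw [show -(ex (-z) * ex (-u - τ / 2)) * th τ (u + z) * deriv (th τ) 0 =
    (-ex (-u - τ/2)) * (ex (-z) * (th τ (u + z) * deriv (th τ) 0)) by ring,
    show -ex (-u - τ / 2) * th τ u * th τ z = (-ex (-u - τ/2)) * (th τ u * th τ z) by ring,
    mul_div_mul_left _ _ (neg_ne_zero.2 h), mul_div_assoc]

lemma kronPhi_add_int {τ : ℂ} (hτ : 0 < τ.im) (m : ℤ) : ∀ (u z : ℂ), kronPhi τ (u + m) z = kronPhi τ u z := by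
  induction m using Int.induction_on with
  | zero => simp
  | succ m ih => intro u z; push_cast; rw [← add_assoc, kronPhi_add_one hτ, ← ih u z]; simp
  | pred m ih => intro u z; rw [← ih u z, ← kronPhi_add_one hτ (u + _)]; push_cast; ring_nf

lemma kronPhi_add_int_tau {τ : ℂ} (hτ : 0 < τ.im) (m : ℤ) :
    ∀ (u z : ℂ), kronPhi τ (u + m * τ) z = ex (-(m * z)) * kronPhi τ u z := by
  induction m using Int.induction_on with
  | zero => simp [ex_zero]
  | succ m ih =>
    intro u z
    have := ih u z
    push_cast at this ⊢
    rw [show u + ((m : ℂ) + 1) * τ = u + m * τ + τ by ring, kronPhi_add_tau hτ, this, ← mul_assoc, ← ex_add]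
    ring_nf
  | pred m ih =>
    intro u z
    have := ih u z
    have h2 := kronPhi_add_tau hτ (u + ((-(m : ℤ) - 1 : ℤ) : ℂ) * τ) z
    rw [show u + ((-(m : ℤ) - 1 : ℤ) : ℂ) * τ + τ = u + ((-(m : ℤ) : ℤ) : ℂ) * τ by push_cast; ring, this] at h2
    apply mul_left_cancel₀ (ex_ne (-z))
    rw [← h2, ← mul_assoc, ← ex_add]
    push_cast; ring_nf

def cong (N : ℕ) (γ β : ℤ × ℤ) : Prop := ∃ δ : ℤ × ℤ, γ = (β.1 + N * δ.1, β.2 + N * δ.2)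

lemma phiG_cong {τ : ℂ} (hτ : 0 < τ.im) {N : ℕ} (hN : N ≠ 0) {γ β : ℤ × ℤ} (h : cong N γ β) (z : ℂ) :
    phiG N τ γ z = phiG N τ β z := by
  obtain ⟨δ, rfl⟩ := h
  have hN' : (N : ℂ) ≠ 0 := by exact_mod_cast hN
  unfold phiG om
  have : (((β.1 + N * δ.1 : ℤ) : ℂ) + ((β.2 + N * δ.2 : ℤ) : ℂ) * τ) / N = (β.1 + β.2 * τ) / N + δ.1 + δ.2 * τ := by
    push_cast; field_simp; ring
  simp only
  rw [this, kronPhi_add_int_tau hτ, kronPhi_add_int hτ, ← mul_assoc]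
  congr 1
  rw [eN_eq, eN_eq, ← ex_add]
  congr 1
  push_cast; field_simp; ring

lemma om_mem {τ : ℂ} (hτ : 0 < τ.im) {N : ℕ} (hN : N ≠ 0) {γ : ℤ × ℤ} (h : om N τ γ ∈ latticeGamma τ) :
    cong N γ 0 := by
  obtain ⟨m, n, h⟩ := h
  have hN' : (N : ℂ) ≠ 0 := by exact_mod_cast hN
  unfold om at h
  rw [div_eq_iff hN'] at h
  have h2 := congrArg Complex.im h
  have h1 := congrArg Complex.re h
  simp at h1 h2
  have e2 : (γ.2 : ℝ) = N * n := by
    apply mul_right_cancel₀ hτ.ne'; rw [h2]; ring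
  have e1 : (γ.1 : ℝ) = N * m := by
    rw [e2] at h1; linarith
  refine ⟨(m, n), ?_⟩
  ext
  · simp; exact_mod_cast e1
  · simp; exact_mod_cast e2

lemma phiG_eq {τ : ℂ} (hτ : 0 < τ.im) (N : ℕ) (γ : ℤ × ℤ) (z : ℂ) :
    phiG N τ γ z = eN N (γ.2 * z) * (th τ (om N τ γ + z) * deriv (th τ) 0 / (th τ (om N τ γ) * th τ z)) := by
  unfold phiG; rw [kronPhi_eq hτ]

lemma om_add (N : ℕ) (τ : ℂ) (γ β : ℤ × ℤ) : om N τ (γ + β) = om N τ γ + om N τ β := by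
  unfold om; simp; ring

lemma lattice_neg {τ z : ℂ} (h : z ∈ latticeGamma τ) : -z ∈ latticeGamma τ := by
  obtain ⟨m, n, rfl⟩ := h
  exact ⟨-m, -n, by push_cast; ring⟩

lemma phiG_fay {τ : ℂ} (hτ : 0 < τ.im) {N : ℕ} (hN : N ≠ 0) {γ β : ℤ × ℤ} (hγ : ¬ cong N γ 0)
    (hβ : ¬ cong N β 0) (hγβ : ¬ cong N (γ + β) 0) {x₁ x₂ : ℂ} (h1 : x₁ ∉ latticeGamma τ)
    (h2 : x₂ ∉ latticeGamma τ) (h12 : x₁ - x₂ ∉ latticeGamma τ) :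
    phiG N τ γ x₁ * phiG N τ β x₂ = phiG N τ γ (x₁ - x₂) * phiG N τ (γ + β) x₂
      + phiG N τ β (x₂ - x₁) * phiG N τ (γ + β) x₁ := by
  have hx := theta_ne hτ h1
  have hy := theta_ne hτ h2
  have hxy := theta_ne hτ h12
  have hu := theta_ne hτ (fun h => hγ (om_mem hτ hN h))
  have hv := theta_ne hτ (fun h => hβ (om_mem hτ hN h))
  have huv := theta_ne hτ (fun h => hγβ (om_mem hτ hN h))
  have hyx : th τ (x₂ - x₁) = - th τ (x₁ - x₂) := by rw [← th_neg, neg_sub]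
  have hF := th_fay hτ (om N τ γ) (om N τ β) x₁ x₂
  simp only [phiG_eq hτ]
  rw [om_add] at *
  rw [hyx]
  have e1 : eN N (γ.2 * (x₁ - x₂)) * eN N (((γ + β).2 : ℤ) * x₂) = eN N (γ.2 * x₁) * eN N (β.2 * x₂) := by
    rw [← eN_add, ← eN_add]; congr 1; simp; ring
  have e2 : eN N (β.2 * (x₂ - x₁)) * eN N (((γ + β).2 : ℤ) * x₁) = eN N (γ.2 * x₁) * eN N (β.2 * x₂) := by
    rw [← eN_add, ← eN_add]; congr 1; simp; ring
  rw [mul_mul_mul_comm, mul_mul_mul_comm _ _ (eN N (((γ + β).2 : ℤ) * x₂)), mul_mul_mul_comm _ _ (eN N (((γ + β).2 : ℤ) * x₁)), e1, e2, ← mul_add]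
  congr 1
  generalize om N τ γ = u at *
  generalize om N τ β = v at *
  field_simp
  linear_combination (deriv (th τ) 0 ^ 2) * hF

lemma th_lattice {τ z : ℂ} (h : z ∈ latticeGamma τ) : th τ z = 0 := by
  obtain ⟨m, n, rfl⟩ := h
  have g1 : ∀ m : ℤ, th τ m = 0 := by
    intro m
    induction m using Int.induction_on with
    | zero => simp [th_zero]
    | succ m ih => push_cast at ih ⊢; rw [th_add_one, ih, neg_zero]
    | pred m ih =>
      have := th_add_one τ (((-(m : ℤ) - 1 : ℤ) : ℂ))
      rw [show (((-(m : ℤ) - 1 : ℤ) : ℂ)) + 1 = ((-(m : ℤ) : ℤ) : ℂ) by push_cast; ring, ih] at this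
      exact neg_eq_zero.1 this.symm
  induction n using Int.induction_on with
  | zero => simp [g1]
  | succ n ih =>
    rw [show (m : ℂ) + (((n : ℤ) + 1 : ℤ) : ℂ) * τ = m + ((n : ℤ) : ℂ) * τ + τ by push_cast; ring, th_add_tau, ih, mul_zero]
  | pred n ih =>
    have := th_add_tau τ (m + ((-(n : ℤ) - 1 : ℤ) : ℂ) * τ)
    rw [show (m : ℂ) + ((-(n : ℤ) - 1 : ℤ) : ℂ) * τ + τ = m + ((-(n : ℤ) : ℤ) : ℂ) * τ by push_cast; ring, ih] at this
    have h2 := (mul_eq_zero.1 this.symm).resolve_left (neg_ne_zero.2 (ex_ne _))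
    exact h2

lemma eventually_not_mem {τ : ℂ} (hτ : 0 < τ.im) (z v : ℂ) :
    ∀ᶠ w in nhdsWithin z {z}ᶜ, w - v ∉ latticeGamma τ := by
  have hd : Differentiable ℂ (fun w => th τ (w + -v)) := (differentiable_th hτ).comp (by fun_prop)
  rcases (hd.analyticAt z).eventually_eq_zero_or_eventually_ne_zero with h | h
  · have := analyticOrderAt_eq_top.2 h
    rw [order_shift] at this
    exact absurd this (th_order_ne_top hτ _)
  · filter_upwards [h] with w hw hmem
    exact hw (by rw [← sub_eq_add_neg]; exact th_lattice hmem)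

lemma eN_continuous (N : ℕ) : Continuous (eN N) := by unfold eN; fun_prop

lemma phiG_continuousAt {τ : ℂ} (hτ : 0 < τ.im) {N : ℕ} (hN : N ≠ 0) {γ : ℤ × ℤ} (hγ : ¬ cong N γ 0)
    {z : ℂ} (hz : z ∉ latticeGamma τ) : ContinuousAt (phiG N τ γ) z := by
  have hx := theta_ne hτ hz
  have hu := theta_ne hτ (fun h => hγ (om_mem hτ hN h))
  have hc := (differentiable_th hτ).continuous
  have he := eN_continuous N
  rw [show phiG N τ γ = _ from funext (phiG_eq hτ N γ)]
  apply ContinuousAt.mul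
  · fun_prop
  · apply ContinuousAt.div
    · fun_prop
    · fun_prop
    · exact mul_ne_zero hu hx

lemma phiG_residue {τ : ℂ} (hτ : 0 < τ.im) {N : ℕ} (hN : N ≠ 0) {γ : ℤ × ℤ} (hγ : ¬ cong N γ 0) :
    Filter.Tendsto (fun w => w * phiG N τ γ w) (nhdsWithin 0 {0}ᶜ) (nhds 1) := by
  have hu := theta_ne hτ (fun h => hγ (om_mem hτ hN h))
  have hK := th_deriv_zero hτ
  have hc := (differentiable_th hτ).continuous
  have he := eN_continuous N
  have h1 : Filter.Tendsto (fun w => w⁻¹ * th τ w) (nhdsWithin 0 {0}ᶜ) (nhds (deriv (th τ) 0)) := by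
    have := ((differentiable_th hτ) 0).hasDerivAt.tendsto_slope
    refine this.congr ?_
    intro w
    simp [slope_def_field, th_zero]; ring
  have h2 : Filter.Tendsto (fun w => eN N (γ.2 * w) * (th τ (om N τ γ + w) * deriv (th τ) 0 / th τ (om N τ γ)))
      (nhdsWithin 0 {0}ᶜ) (nhds (deriv (th τ) 0)) := by
    have hcc : Continuous (fun w => eN N (γ.2 * w) * (th τ (om N τ γ + w) * deriv (th τ) 0 / th τ (om N τ γ))) := by fun_prop
    have := (hcc.tendsto 0).mono_left (nhdsWithin_le_nhds (s := {0}ᶜ))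
    simp only [mul_zero, eN_zero, add_zero, one_mul] at this
    rwa [mul_div_cancel_left₀ _ hu] at this
  have h3 := h2.div h1 hK
  rw [div_self hK] at h3
  refine h3.congr' ?_
  filter_upwards [self_mem_nhdsWithin] with w hw
  have hw : w ≠ 0 := hw
  rw [phiG_eq hτ]
  simp only [Pi.div_apply]
  simp only [div_eq_mul_inv, mul_inv, inv_inv]
  ring

/-! ### The matrix algebra -/

def Xm (N : ℕ) (a b : ℤ) : Matrix (Fin N) (Fin N) ℂ :=
  Matrix.of fun i j => if (N : ℤ) ∣ ((i : ℕ) : ℤ) + b - ((j : ℕ) : ℤ) then eN N (a * ((i : ℕ) + 1)) else 0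

lemma eN_cong {N : ℕ} (hN : N ≠ 0) {m m' : ℤ} (h : (N : ℤ) ∣ m - m') : eN N m = eN N m' := by
  obtain ⟨d, hd⟩ := h
  have : (m : ℂ) = m' + N * d := by
    have : m = m' + N * d := by linarith
    rw [this]; push_cast; ring
  rw [this, eN_add, eN_mul_int hN, mul_one]

lemma eN_one_dvd {N : ℕ} (hN : N ≠ 0) {m : ℤ} (h : eN N m = 1) : (N : ℤ) ∣ m := by
  rw [eN_eq] at h
  obtain ⟨d, hd⟩ := ex_eq_one h
  have hN' : (N : ℂ) ≠ 0 := by exact_mod_cast hN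
  rw [div_eq_iff hN'] at hd
  refine ⟨d, ?_⟩
  have : (m : ℂ) = ((N * d : ℤ) : ℂ) := by rw [hd]; push_cast; ring
  exact_mod_cast this

lemma exists_fin {N : ℕ} (hN : N ≠ 0) (m : ℤ) : ∃ j : Fin N, (N : ℤ) ∣ m - ((j : ℕ) : ℤ) := by
  have hN' : (N : ℤ) ≠ 0 := by exact_mod_cast hN
  have h0 := Int.emod_nonneg m hN'
  have h1 := Int.emod_lt_of_pos m (b := (N : ℤ)) (by omega)
  refine ⟨⟨(m % N).toNat, by omega⟩, ?_⟩
  simp only [Int.toNat_of_nonneg h0]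
  exact Int.dvd_self_sub_emod

lemma fin_unique {N : ℕ} {i j : Fin N} (h : (N : ℤ) ∣ ((i : ℕ) : ℤ) - ((j : ℕ) : ℤ)) : i = j := by
  have hi := i.2
  have hj := j.2
  have h3 := Int.eq_zero_of_abs_lt_dvd h (by rw [abs_lt]; constructor <;> omega)
  exact Fin.ext (by omega)

lemma Xm_mul {N : ℕ} (hN : N ≠ 0) (a b a' b' : ℤ) :
    Xm N a b * Xm N a' b' = eN N ((b * a' : ℤ) : ℂ) • Xm N (a + a') (b + b') := by
  ext i k
  obtain ⟨j, hj⟩ := exists_fin hN (((i : ℕ) : ℤ) + b)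
  rw [Matrix.mul_apply, Finset.sum_eq_single j]
  · simp only [Xm, Matrix.of_apply, Matrix.smul_apply, if_pos hj, smul_eq_mul]
    have hiff : ((N : ℤ) ∣ ((j : ℕ) : ℤ) + b' - ((k : ℕ) : ℤ)) ↔ ((N : ℤ) ∣ ((i : ℕ) : ℤ) + (b + b') - ((k : ℕ) : ℤ)) := by
      have : ((i : ℕ) : ℤ) + (b + b') - ((k : ℕ) : ℤ) = (((j : ℕ) : ℤ) + b' - ((k : ℕ) : ℤ)) + (((i : ℕ) : ℤ) + b - ((j : ℕ) : ℤ)) := by ring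
      rw [this]
      exact (dvd_add_left hj).symm
    by_cases h : (N : ℤ) ∣ ((j : ℕ) : ℤ) + b' - ((k : ℕ) : ℤ)
    · rw [if_pos h, if_pos (hiff.1 h)]
      rw [show eN N ((a' : ℂ) * ((j : ℕ) + 1)) = eN N ((a' * (((i : ℕ) : ℤ) + b + 1) : ℤ) : ℂ) from ?_, ← eN_add, ← eN_add]
      · congr 1; push_cast; ring
      · rw [← eN_cong hN (m := a' * (((j : ℕ) : ℤ) + 1))]
        · congr 1; push_cast; ring
        · have : a' * (((j : ℕ) : ℤ) + 1) - a' * (((i : ℕ) : ℤ) + b + 1) = (((i : ℕ) : ℤ) + b - ((j : ℕ) : ℤ)) * (-a') := by ring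
          rw [this]; exact Dvd.dvd.mul_right hj _
    · rw [if_neg h, if_neg (fun h' => h (hiff.2 h'))]; simp
  · intro l _ hl
    have : ¬ (N : ℤ) ∣ ((i : ℕ) : ℤ) + b - ((l : ℕ) : ℤ) := by
      intro h
      apply hl
      apply fin_unique
      have := dvd_sub hj h
      rwa [sub_sub_sub_cancel_left] at this
    simp [Xm, this]
  · intro h; exact absurd (Finset.mem_univ _) h

lemma Xm_zero (N : ℕ) : Xm N 0 0 = 1 := by
  ext i j
  simp only [Xm, Matrix.of_apply, Matrix.one_apply, add_zero, Int.cast_zero, zero_mul, eN_zero]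
  congr 1
  refine propext ⟨fin_unique, ?_⟩
  rintro rfl; simp

lemma Xm_one_zero (N : ℕ) : Qm N = Xm N 1 0 := by
  ext i j
  simp only [Xm, Qm, Matrix.of_apply, Matrix.diagonal_apply, add_zero, Int.cast_one, one_mul]
  congr 1
  refine propext ⟨?_, fin_unique⟩
  rintro rfl; simp

lemma Xm_zero_one (N : ℕ) : Lm N = Xm N 0 1 := by
  ext i j
  simp only [Xm, Lm, Matrix.of_apply, Int.cast_zero, zero_mul, eN_zero]
  congr 1
  refine propext ⟨?_, ?_⟩
  · intro h
    rw [← h]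
    push_cast
    exact Int.dvd_self_sub_emod
  · intro h
    have hj := j.2
    have h2 : ((((i : ℕ) + 1 : ℕ) : ℤ)) % N = ((j : ℕ) : ℤ) % N := by
      apply Int.emod_eq_emod_iff_emod_sub_eq_zero.2
      apply Int.emod_eq_zero_of_dvd
      push_cast; exact h
    rw [Int.emod_eq_of_lt (a := ((j : ℕ) : ℤ)) (by omega) (by omega)] at h2
    exact_mod_cast h2

lemma pow_hom {N : ℕ} (f : ℤ → Matrix (Fin N) (Fin N) ℂ) (h0 : f 0 = 1)
    (hadd : ∀ a b, f (a + b) = f a * f b) (m : ℤ) : f 1 ^ m = f m := by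
  have hn : ∀ k : ℕ, f 1 ^ k = f k := by
    intro k
    induction k with
    | zero => simp [h0]
    | succ k ih => rw [pow_succ, ih, ← hadd]; push_cast; rfl
  cases m with
  | ofNat k => simpa using hn k
  | negSucc k =>
    rw [zpow_negSucc, hn]
    apply Matrix.inv_eq_right_inv
    rw [← hadd, ← h0]
    congr 1
    rw [Int.negSucc_eq]; push_cast; ring

lemma Tm_eq {N : ℕ} (hN : N ≠ 0) (γ : ℤ × ℤ) :
    Tm N γ = eN N (((γ.1 * γ.2 : ℤ) : ℂ) / 2) • Xm N γ.1 γ.2 := by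
  unfold Tm
  rw [Xm_one_zero, Xm_zero_one, pow_hom (fun m => Xm N m 0) (Xm_zero N), pow_hom (fun m => Xm N 0 m) (Xm_zero N), Xm_mul hN]
  · simp [eN_zero]
  · intro a b; rw [Xm_mul hN]; simp [eN_zero]
  · intro a b; rw [Xm_mul hN]; simp [eN_zero]

lemma Tm_mul {N : ℕ} (hN : N ≠ 0) (γ β : ℤ × ℤ) :
    Tm N γ * Tm N β = eN N (((γ.2 * β.1 - γ.1 * β.2 : ℤ) : ℂ) / 2) • Tm N (γ + β) := by
  simp only [Tm_eq hN, Matrix.smul_mul, Matrix.mul_smul, smul_smul, Xm_mul hN, ← eN_add, Prod.fst_add, Prod.snd_add]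
  congr 2
  push_cast; ring

lemma Tm_zero {N : ℕ} (hN : N ≠ 0) : Tm N 0 = 1 := by
  rw [Tm_eq hN]; simp [eN_zero, Xm_zero]

lemma Xm_cong {N : ℕ} (hN : N ≠ 0) {γ β : ℤ × ℤ} (h : cong N γ β) : Xm N γ.1 γ.2 = Xm N β.1 β.2 := by
  obtain ⟨δ, rfl⟩ := h
  ext i j
  simp only [Xm, Matrix.of_apply]
  congr 1
  · apply propext
    have : ((i : ℕ) : ℤ) + (β.2 + N * δ.2) - ((j : ℕ) : ℤ) = (((i : ℕ) : ℤ) + β.2 - ((j : ℕ) : ℤ)) + N * δ.2 := by ring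
    rw [this]
    exact dvd_add_left (Dvd.intro _ rfl)
  · have := eN_cong hN (m := (β.1 + N * δ.1) * (((i : ℕ) : ℤ) + 1)) (m' := β.1 * (((i : ℕ) : ℤ) + 1))
      ⟨δ.1 * (((i : ℕ) : ℤ) + 1), by ring⟩
    push_cast at this ⊢
    exact this

lemma Tm_cong {N : ℕ} (hN : N ≠ 0) {γ β : ℤ × ℤ} (h : cong N γ β) : ∃ s : ℂ, Tm N γ = s • Tm N β := by
  refine ⟨eN N (((γ.1 * γ.2 : ℤ) : ℂ) / 2) * (eN N (((β.1 * β.2 : ℤ) : ℂ) / 2))⁻¹, ?_⟩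
  rw [Tm_eq hN, Tm_eq hN, Xm_cong hN h, smul_smul, mul_assoc, inv_mul_cancel₀ (eN_ne _ _), mul_one]

lemma Tm_comm_zero {N : ℕ} (hN : N ≠ 0) {γ β : ℤ × ℤ} (h : cong N (γ + β) 0) :
    Tm N γ * Tm N β = Tm N β * Tm N γ := by
  rw [Tm_mul hN, Tm_mul hN, add_comm β γ]
  congr 1
  have e : (((γ.2 * β.1 - γ.1 * β.2 : ℤ) : ℂ) / 2) = (((β.2 * γ.1 - β.1 * γ.2 : ℤ) : ℂ) / 2) + ((γ.2 * β.1 - γ.1 * β.2 : ℤ) : ℂ) := by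
    push_cast; ring
  rw [e, eN_add, ]
  obtain ⟨δ, hδ⟩ := h
  have h1 := congrArg Prod.fst hδ
  have h2 := congrArg Prod.snd hδ
  simp at h1 h2
  have := eN_cong hN (m := γ.2 * β.1 - γ.1 * β.2) (m' := 0) ⟨γ.2 * δ.1 - γ.1 * δ.2, by
    have e1 : β.1 = N * δ.1 - γ.1 := by linarith
    have e2 : β.2 = N * δ.2 - γ.2 := by linarith
    rw [e1, e2]; ring⟩
  rw [this]; simp [eN_zero]

lemma Tm_trace {N : ℕ} (hN : N ≠ 0) {γ : ℤ × ℤ} (h : ¬ cong N γ 0) : (Tm N γ).trace = 0 := by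
  have key : ∀ α : ℤ × ℤ, (eN N ((α.2 * γ.1 - α.1 * γ.2 : ℤ) : ℂ) - 1) * (Tm N γ).trace = 0 := by
    intro α
    have h1 : Tm N α * Tm N γ * Tm N (-α) = eN N ((α.2 * γ.1 - α.1 * γ.2 : ℤ) : ℂ) • Tm N γ := by
      rw [Tm_mul hN, Matrix.smul_mul, Tm_mul hN, smul_smul, ← eN_add]
      rw [show α + γ + -α = γ by abel]
      congr 2
      simp; ring
    have h2 : Tm N (-α) * Tm N α = 1 := by
      rw [Tm_mul hN, neg_add_cancel, Tm_zero hN]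
      rw [show ((-α).2 * α.1 - (-α).1 * α.2) = 0 by simp; ring]
      simp [eN_zero]
    have h3 := congrArg Matrix.trace h1
    rw [Matrix.trace_mul_comm, ← mul_assoc, h2, one_mul, Matrix.trace_smul, smul_eq_mul] at h3
    linear_combination -h3
  by_contra hne
  apply h
  have k1 := eN_one_dvd hN (sub_eq_zero.1 ((mul_eq_zero.1 (key (0, 1))).resolve_right hne))
  have k2 := eN_one_dvd hN (sub_eq_zero.1 ((mul_eq_zero.1 (key (-1, 0))).resolve_right hne))
  simp at k1 k2
  obtain ⟨d1, e1⟩ := k1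
  obtain ⟨d2, e2⟩ := k2
  exact ⟨(d1, d2), Prod.ext (by simp [e1]) (by simp [e2])⟩

lemma Tm_pair {N : ℕ} (hN : N ≠ 0) (γ : ℤ × ℤ) : (Tm N (-γ) * Tm N γ).trace = N := by
  rw [Tm_mul hN, neg_add_cancel, Tm_zero hN]
  rw [show ((-γ).2 * γ.1 - (-γ).1 * γ.2) = 0 by simp; ring]
  simp [eN_zero]

lemma Tm_pair_ne {N : ℕ} (hN : N ≠ 0) {γ β : ℤ × ℤ} (h : ¬ cong N β γ) : (Tm N (-γ) * Tm N β).trace = 0 := by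
  rw [Tm_mul hN, Matrix.trace_smul, Tm_trace hN, smul_zero]
  rintro ⟨δ, hδ⟩
  apply h
  have h1 := congrArg Prod.fst hδ
  have h2 := congrArg Prod.snd hδ
  simp at h1 h2
  exact ⟨δ, Prod.ext (by simp; linarith) (by simp; linarith)⟩

lemma mem_GammaN {N : ℕ} {γ : ℤ × ℤ} : γ ∈ GammaN' N ↔ (0 ≤ γ.1 ∧ γ.1 < N) ∧ (0 ≤ γ.2 ∧ γ.2 < N) ∧ γ ≠ 0 := by
  unfold GammaN'
  simp only [Finset.mem_sdiff, Finset.mem_image, Finset.mem_product, Finset.mem_range, Finset.mem_singleton]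
  constructor
  · rintro ⟨⟨p, ⟨h1, h2⟩, rfl⟩, h⟩
    refine ⟨⟨by simp, by simpa using h1⟩, ⟨by simp, by simpa using h2⟩, h⟩
  · rintro ⟨⟨h1, h2⟩, ⟨h3, h4⟩, h⟩
    refine ⟨⟨(γ.1.toNat, γ.2.toNat), ⟨by simp only; omega, by simp only; omega⟩, Prod.ext (by simp [h1]) (by simp [h3])⟩, h⟩

lemma cong_unique {N : ℕ} {γ β : ℤ × ℤ} (hγ : (0 ≤ γ.1 ∧ γ.1 < N) ∧ (0 ≤ γ.2 ∧ γ.2 < N))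
    (hβ : (0 ≤ β.1 ∧ β.1 < N) ∧ (0 ≤ β.2 ∧ β.2 < N)) (h : cong N γ β) : γ = β := by
  obtain ⟨δ, hδ⟩ := h
  have h1 := congrArg Prod.fst hδ
  have h2 := congrArg Prod.snd hδ
  simp at h1 h2
  have e1 := Int.eq_zero_of_abs_lt_dvd (m := N) (x := γ.1 - β.1) ⟨δ.1, by rw [h1]; ring⟩ (by rw [abs_lt]; constructor <;> omega)
  have e2 := Int.eq_zero_of_abs_lt_dvd (m := N) (x := γ.2 - β.2) ⟨δ.2, by rw [h2]; ring⟩ (by rw [abs_lt]; constructor <;> omega)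
  exact Prod.ext (by omega) (by omega)

lemma GammaN_ncong {N : ℕ} (hN : N ≠ 0) {γ : ℤ × ℤ} (h : γ ∈ GammaN' N) : ¬ cong N γ 0 := by
  have h' := mem_GammaN.1 h
  intro hc
  exact h'.2.2 (cong_unique ⟨h'.1, h'.2.1⟩ ⟨⟨le_refl _, by simp; omega⟩, ⟨le_refl _, by simp; omega⟩⟩ hc)

lemma exists_rep {N : ℕ} (hN : N ≠ 0) {γ : ℤ × ℤ} (h : ¬ cong N γ 0) : ∃ β ∈ GammaN' N, cong N γ β := by
  have hN' : (N : ℤ) ≠ 0 := by exact_mod_cast hN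
  have hc : cong N γ (γ.1 % N, γ.2 % N) :=
    ⟨(γ.1 / N, γ.2 / N), Prod.ext (Int.emod_add_mul_ediv _ _).symm (Int.emod_add_mul_ediv _ _).symm⟩
  refine ⟨_, mem_GammaN.2 ⟨⟨Int.emod_nonneg _ hN', Int.emod_lt_of_pos _ (by omega)⟩, ⟨Int.emod_nonneg _ hN', Int.emod_lt_of_pos _ (by omega)⟩, ?_⟩, hc⟩
  intro h0
  rw [h0] at hc
  exact h hc

/-! ### The operator `φ̂_w` -/

def Dm (N : ℕ) (τ w : ℂ) : Matrix (Fin N) (Fin N) ℂ →ₗ[ℂ] Matrix (Fin N) (Fin N) ℂ :=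
  ∑ γ ∈ GammaN' N, (phiG N τ γ w * (N : ℂ)⁻¹) •
    (((Matrix.traceLinearMap (Fin N) ℂ ℂ).comp (LinearMap.mulLeft ℂ (Tm N (-γ)))).smulRight (Tm N γ))

lemma Dm_apply (N : ℕ) (τ w : ℂ) (M : Matrix (Fin N) (Fin N) ℂ) :
    Dm N τ w M = ∑ γ ∈ GammaN' N, (phiG N τ γ w * (N : ℂ)⁻¹ * (Tm N (-γ) * M).trace) • Tm N γ := by
  simp [Dm, LinearMap.sum_apply, smul_smul]

lemma Dm_Tm {τ : ℂ} (hτ : 0 < τ.im) {N : ℕ} (hN : N ≠ 0) (w : ℂ) {γ : ℤ × ℤ} (h : ¬ cong N γ 0) :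
    Dm N τ w (Tm N γ) = phiG N τ γ w • Tm N γ := by
  have hN' : (N : ℂ) ≠ 0 := by exact_mod_cast hN
  obtain ⟨β, hβ, hc⟩ := exists_rep hN h
  obtain ⟨s, hs⟩ := Tm_cong hN hc
  rw [hs, map_smul, phiG_cong hτ hN hc, smul_comm]
  congr 1
  rw [Dm_apply, Finset.sum_eq_single β]
  · rw [Tm_pair hN, mul_assoc, inv_mul_cancel₀ hN', mul_one]
  · intro α hα hne
    rw [Tm_pair_ne hN, mul_zero, zero_smul]
    intro hcc
    have h1 := mem_GammaN.1 hα
    have h2 := mem_GammaN.1 hβ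
    exact hne (cong_unique ⟨h2.1, h2.2.1⟩ ⟨h1.1, h1.2.1⟩ hcc).symm
  · intro h; exact absurd hβ h

def Vm (N : ℕ) : Submodule ℂ (Matrix (Fin N) (Fin N) ℂ) := Submodule.span ℂ (Tm N '' {γ | ¬ cong N γ 0})

lemma Tm_mem {N : ℕ} {γ : ℤ × ℤ} (h : ¬ cong N γ 0) : Tm N γ ∈ Vm N := Submodule.subset_span ⟨γ, h, rfl⟩

lemma sum_mem_V {N : ℕ} (hN : N ≠ 0) (f : ℤ × ℤ → ℂ) : ∑ γ ∈ GammaN' N, f γ • Tm N γ ∈ Vm N :=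
  Submodule.sum_mem _ fun _ h => Submodule.smul_mem _ _ (Tm_mem (GammaN_ncong hN h))

lemma Dm_mem {N : ℕ} (hN : N ≠ 0) (τ w : ℂ) (M : Matrix (Fin N) (Fin N) ℂ) : Dm N τ w M ∈ Vm N := by
  rw [Dm_apply]; exact sum_mem_V hN _

lemma Dm_sum {τ : ℂ} (hτ : 0 < τ.im) {N : ℕ} (hN : N ≠ 0) (w : ℂ) (f : ℤ × ℤ → ℂ) :
    Dm N τ w (∑ γ ∈ GammaN' N, f γ • Tm N γ) = ∑ γ ∈ GammaN' N, (f γ * phiG N τ γ w) • Tm N γ := by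
  rw [map_sum]
  refine Finset.sum_congr rfl fun γ h => ?_
  rw [map_smul, Dm_Tm hτ hN w (GammaN_ncong hN h), smul_smul]

lemma V_ind2 {N : ℕ} {P : Matrix (Fin N) (Fin N) ℂ → Matrix (Fin N) (Fin N) ℂ → Prop}
    (hT : ∀ γ β, ¬ cong N γ 0 → ¬ cong N β 0 → P (Tm N γ) (Tm N β))
    (h0l : ∀ B, P 0 B) (h0r : ∀ A, P A 0)
    (hal : ∀ A A' B, P A B → P A' B → P (A + A') B) (har : ∀ A B B', P A B → P A B' → P A (B + B'))
    (hsl : ∀ (s : ℂ) A B, P A B → P (s • A) B) (hsr : ∀ (s : ℂ) A B, P A B → P A (s • B))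
    {A B : Matrix (Fin N) (Fin N) ℂ} (hA : A ∈ Vm N) (hB : B ∈ Vm N) : P A B := by
  unfold Vm at hA hB
  induction hA using Submodule.span_induction with
  | mem x hx =>
    obtain ⟨γ, hγ, rfl⟩ := hx
    induction hB using Submodule.span_induction with
    | mem y hy =>
      obtain ⟨β, hβ, rfl⟩ := hy
      exact hT γ β hγ hβ
    | zero => exact h0r _
    | add y y' _ _ h h' => exact har _ _ _ h h'
    | smul s y _ h => exact hsr _ _ _ h
  | zero => exact h0l _
  | add y y' _ _ h h' => exact hal _ _ _ h h'
  | smul s y _ h => exact hsl _ _ _ h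

lemma comm_mem {N : ℕ} (hN : N ≠ 0) {A B : Matrix (Fin N) (Fin N) ℂ} (hA : A ∈ Vm N) (hB : B ∈ Vm N) :
    A * B - B * A ∈ Vm N := by
  refine V_ind2 (P := fun A B => A * B - B * A ∈ Vm N) ?_ ?_ ?_ ?_ ?_ ?_ ?_ hA hB
  · intro γ β hγ hβ
    by_cases h : cong N (γ + β) 0
    · rw [Tm_comm_zero hN h, sub_self]; exact Submodule.zero_mem _
    · rw [Tm_mul hN, Tm_mul hN, add_comm β γ, ← sub_smul]
      exact Submodule.smul_mem _ _ (Tm_mem h)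
  · intro B; simp
  · intro A; simp
  · intro A A' B h h'
    convert Submodule.add_mem _ h h' using 1; noncomm_ring
  · intro A B B' h h'
    convert Submodule.add_mem _ h h' using 1; noncomm_ring
  · intro s A B h
    convert Submodule.smul_mem _ s h using 1; simp [smul_sub]
  · intro s A B h
    convert Submodule.smul_mem _ s h using 1; simp [smul_sub]

lemma Dm_fay {τ : ℂ} (hτ : 0 < τ.im) {N : ℕ} (hN : N ≠ 0) {x₁ x₂ : ℂ} (h1 : x₁ ∉ latticeGamma τ)
    (h2 : x₂ ∉ latticeGamma τ) (h12 : x₁ - x₂ ∉ latticeGamma τ)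
    {A B : Matrix (Fin N) (Fin N) ℂ} (hA : A ∈ Vm N) (hB : B ∈ Vm N) :
    Dm N τ x₁ A * Dm N τ x₂ B - Dm N τ x₂ B * Dm N τ x₁ A
      = Dm N τ x₂ (Dm N τ (x₁ - x₂) A * B - B * Dm N τ (x₁ - x₂) A)
        + Dm N τ x₁ (A * Dm N τ (x₂ - x₁) B - Dm N τ (x₂ - x₁) B * A) := by
  refine V_ind2 (P := fun A B => Dm N τ x₁ A * Dm N τ x₂ B - Dm N τ x₂ B * Dm N τ x₁ A
      = Dm N τ x₂ (Dm N τ (x₁ - x₂) A * B - B * Dm N τ (x₁ - x₂) A)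
        + Dm N τ x₁ (A * Dm N τ (x₂ - x₁) B - Dm N τ (x₂ - x₁) B * A)) ?_ ?_ ?_ ?_ ?_ ?_ ?_ hA hB
  · intro γ β hγ hβ
    simp only [Dm_Tm hτ hN _ hγ, Dm_Tm hτ hN _ hβ, Matrix.smul_mul, Matrix.mul_smul]
    by_cases h : cong N (γ + β) 0
    · rw [Tm_comm_zero hN h]
      rw [smul_comm (phiG N τ γ x₁), sub_self, sub_self, sub_self, map_zero, map_zero, add_zero]
    · rw [Tm_mul hN, Tm_mul hN, add_comm β γ]
      simp only [map_sub, map_smul, Dm_Tm hτ hN _ h, smul_smul, ← sub_smul, ← add_smul]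
      congr 1
      linear_combination (eN N (((γ.2 * β.1 - γ.1 * β.2 : ℤ) : ℂ) / 2) - eN N (((β.2 * γ.1 - β.1 * γ.2 : ℤ) : ℂ) / 2)) * phiG_fay hτ hN hγ hβ h h1 h2 h12
  · intro B; simp
  · intro A; simp
  · intro A A' B h h'
    have := congrArg₂ (· + ·) h h'
    simp only [map_add, map_sub, add_mul, mul_add] at this ⊢
    rw [← sub_eq_zero] at this ⊢
    rw [← this]; abel
  · intro A B B' h h'
    have := congrArg₂ (· + ·) h h'
    simp only [map_add, map_sub, add_mul, mul_add] at this ⊢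
    rw [← sub_eq_zero] at this ⊢
    rw [← this]; abel
  · intro s A B h
    have := congrArg (s • ·) h
    simpa only [map_smul, Matrix.smul_mul, Matrix.mul_smul, ← smul_sub, ← smul_add] using this
  · intro s A B h
    have := congrArg (s • ·) h
    simpa only [map_smul, Matrix.smul_mul, Matrix.mul_smul, ← smul_sub, ← smul_add] using this

lemma V_repr {N : ℕ} (hN : N ≠ 0) {A : Matrix (Fin N) (Fin N) ℂ} (hA : A ∈ Vm N) :
    ∑ γ ∈ GammaN' N, ((N : ℂ)⁻¹ * (Tm N (-γ) * A).trace) • Tm N γ = A := by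
  have hN' : (N : ℂ) ≠ 0 := by exact_mod_cast hN
  unfold Vm at hA
  induction hA using Submodule.span_induction with
  | mem x hx =>
    obtain ⟨γ, h, rfl⟩ := hx
    obtain ⟨β, hβ, hc⟩ := exists_rep hN h
    obtain ⟨s, hs⟩ := Tm_cong hN hc
    rw [hs, Finset.sum_eq_single β]
    · rw [Matrix.mul_smul, Matrix.trace_smul, Tm_pair hN, smul_eq_mul, mul_left_comm, inv_mul_cancel₀ hN', mul_one]
    · intro α hα hne
      rw [Matrix.mul_smul, Matrix.trace_smul, Tm_pair_ne hN, smul_zero, mul_zero, zero_smul]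
      intro hcc
      have h1 := mem_GammaN.1 hα
      have h2 := mem_GammaN.1 hβ
      exact hne (cong_unique ⟨h2.1, h2.2.1⟩ ⟨h1.1, h1.2.1⟩ hcc).symm
    · intro h; exact absurd hβ h
  | zero => simp
  | add y y' _ _ h h' =>
    simp only [mul_add, Matrix.trace_add, add_smul, Finset.sum_add_distrib, h, h']
  | smul s y _ h =>
    conv_rhs => rw [← h]
    rw [Finset.smul_sum]
    refine Finset.sum_congr rfl fun γ _ => ?_
    rw [Matrix.mul_smul, Matrix.trace_smul, smul_smul, smul_eq_mul]
    congr 1; ring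

lemma Dm_continuousAt {τ : ℂ} (hτ : 0 < τ.im) {N : ℕ} (hN : N ≠ 0) {w : ℂ} (hw : w ∉ latticeGamma τ)
    (M : Matrix (Fin N) (Fin N) ℂ) : ContinuousAt (fun w => Dm N τ w M) w := by
  simp only [Dm_apply]
  refine tendsto_finsetSum _ fun γ h => ?_
  exact (((phiG_continuousAt hτ hN (GammaN_ncong hN h) hw).mul continuousAt_const).mul continuousAt_const).smul continuousAt_const

lemma Dm_residue {τ : ℂ} (hτ : 0 < τ.im) {N : ℕ} (hN : N ≠ 0) {A : Matrix (Fin N) (Fin N) ℂ} (hA : A ∈ Vm N) :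
    Filter.Tendsto (fun w => w • Dm N τ w A) (nhdsWithin 0 {0}ᶜ) (nhds A) := by
  have : Filter.Tendsto (fun w => w • Dm N τ w A) (nhdsWithin 0 {0}ᶜ)
      (nhds (∑ γ ∈ GammaN' N, (1 * ((N : ℂ)⁻¹ * (Tm N (-γ) * A).trace)) • Tm N γ)) := by
    simp only [Dm_apply, Finset.smul_sum, smul_smul]
    refine tendsto_finsetSum _ fun γ h => ?_
    have h1 := ((phiG_residue hτ hN (GammaN_ncong hN h)).mul_const ((N : ℂ)⁻¹ * (Tm N (-γ) * A).trace)).smul_const (Tm N γ)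
    refine h1.congr fun w => ?_
    congr 1; ring
  simp only [one_mul] at this
  rwa [V_repr hN hA] at this

/-! ### The residues of the zero-curvature equation -/

def Am (N : ℕ) (τ : ℂ) {n : ℕ} (z : Fin n → ℂ) (a : Fin n) (k : ℂ)
    (P S : Fin n → Matrix (Fin N) (Fin N) ℂ) (R : Matrix (Fin N) (Fin N) ℂ) (c : Fin n) :
    Matrix (Fin N) (Fin N) ℂ :=
  if c = a then P a - k • R + ∑ c ∈ Finset.univ.filter (fun c => c ≠ a),
      (S a * Dm N τ (z a - z c) (S c) - Dm N τ (z a - z c) (S c) * S a)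
  else P c - (S c * Dm N τ (z c - z a) (S a) - Dm N τ (z c - z a) (S a) * S c)

lemma Am_mem {N : ℕ} (hN : N ≠ 0) (τ : ℂ) {n : ℕ} (z : Fin n → ℂ) (a : Fin n) (k : ℂ)
    {P S : Fin n → Matrix (Fin N) (Fin N) ℂ} {R : Matrix (Fin N) (Fin N) ℂ}
    (hP : ∀ c, P c ∈ Vm N) (hS : ∀ c, S c ∈ Vm N) (hR : R ∈ Vm N) (c : Fin n) :
    Am N τ z a k P S R c ∈ Vm N := by
  unfold Am
  split_ifs
  · exact add_mem (sub_mem (hP _) (Submodule.smul_mem _ _ hR))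
      (sum_mem fun c _ => comm_mem hN (hS _) (Dm_mem hN _ _ _))
  · exact sub_mem (hP _) (comm_mem hN (hS _) (Dm_mem hN _ _ _))

lemma zc_identity {τ : ℂ} (hτ : 0 < τ.im) {N : ℕ} (hN : N ≠ 0) {n : ℕ} {z : Fin n → ℂ}
    (hz : ∀ a c : Fin n, a ≠ c → z a - z c ∉ latticeGamma τ) (a : Fin n) (k : ℂ)
    {P S : Fin n → Matrix (Fin N) (Fin N) ℂ} {R : Matrix (Fin N) (Fin N) ℂ}
    (hS : ∀ c, S c ∈ Vm N) {w : ℂ} (hw : ∀ c, w - z c ∉ latticeGamma τ) :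
    (∑ c, Dm N τ (w - z c) (P c)) - k • Dm N τ (w - z a) R
      - ((∑ c, Dm N τ (w - z c) (S c)) * Dm N τ (w - z a) (S a)
          - Dm N τ (w - z a) (S a) * ∑ c, Dm N τ (w - z c) (S c))
    = ∑ c, Dm N τ (w - z c) (Am N τ z a k P S R c) := by
  have hs : ∀ f : Fin n → Matrix (Fin N) (Fin N) ℂ,
      ∑ c, f c = f a + ∑ c ∈ Finset.univ.filter (fun c => c ≠ a), f c := by
    intro f
    rw [Finset.filter_ne', Finset.add_sum_erase _ _ (Finset.mem_univ a)]
  have h1 : (∑ c, Dm N τ (w - z c) (S c)) * Dm N τ (w - z a) (S a)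
          - Dm N τ (w - z a) (S a) * ∑ c, Dm N τ (w - z c) (S c)
      = ∑ c ∈ Finset.univ.filter (fun c => c ≠ a),
          (-(Dm N τ (w - z a) (S a * Dm N τ (z a - z c) (S c) - Dm N τ (z a - z c) (S c) * S a))
            + Dm N τ (w - z c) (S c * Dm N τ (z c - z a) (S a) - Dm N τ (z c - z a) (S a) * S c)) := by
    rw [Finset.sum_mul, Finset.mul_sum, ← Finset.sum_sub_distrib, hs, sub_self, zero_add]
    refine Finset.sum_congr rfl fun c hc => ?_
    have hc' : c ≠ a := (Finset.mem_filter.1 hc).2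
    have e1 : (w - z c) - (w - z a) = z a - z c := by ring
    have e2 : (w - z a) - (w - z c) = z c - z a := by ring
    have hF := Dm_fay hτ hN (hw c) (hw a) (by rw [e1]; exact hz a c hc'.symm) (hS c) (hS a)
    rw [e1, e2] at hF
    rw [hF, ← map_neg, neg_sub]
  have h2 : ∑ c ∈ Finset.univ.filter (fun c => c ≠ a), Dm N τ (w - z c) (Am N τ z a k P S R c)
      = ∑ c ∈ Finset.univ.filter (fun c => c ≠ a), (Dm N τ (w - z c) (P c)
        - Dm N τ (w - z c) (S c * Dm N τ (z c - z a) (S a) - Dm N τ (z c - z a) (S a) * S c)) := by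
    refine Finset.sum_congr rfl fun c hc => ?_
    have hc' : c ≠ a := (Finset.mem_filter.1 hc).2
    rw [Am, if_neg hc', map_sub]
  have h3 : Dm N τ (w - z a) (Am N τ z a k P S R a) = Dm N τ (w - z a) (P a) - k • Dm N τ (w - z a) R
      + ∑ c ∈ Finset.univ.filter (fun c => c ≠ a),
        Dm N τ (w - z a) (S a * Dm N τ (z a - z c) (S c) - Dm N τ (z a - z c) (S c) * S a) := by
    rw [Am, if_pos rfl, map_add, map_sub, map_smul, map_sum]
  rw [h1, hs (fun c => Dm N τ (w - z c) (P c)), hs (fun c => Dm N τ (w - z c) (Am N τ z a k P S R c)), h2, h3,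
    Finset.sum_add_distrib, Finset.sum_sub_distrib, Finset.sum_neg_distrib]
  abel

lemma residues_zero {τ : ℂ} (hτ : 0 < τ.im) {N : ℕ} (hN : N ≠ 0) {n : ℕ} {z : Fin n → ℂ}
    (hz : ∀ a c : Fin n, a ≠ c → z a - z c ∉ latticeGamma τ)
    {A : Fin n → Matrix (Fin N) (Fin N) ℂ} (hA : ∀ c, A c ∈ Vm N)
    (h : ∀ w : ℂ, (∀ c, w - z c ∉ latticeGamma τ) → ∑ c, Dm N τ (w - z c) (A c) = 0) (b : Fin n) :
    A b = 0 := by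
  have hsub : Filter.Tendsto (fun w => w - z b) (nhdsWithin (z b) {z b}ᶜ) (nhdsWithin 0 {0}ᶜ) := by
    refine tendsto_nhdsWithin_iff.2 ⟨?_, ?_⟩
    · have : Continuous (fun w : ℂ => w - z b) := by fun_prop
      have h2 := (this.tendsto (z b)).mono_left (nhdsWithin_le_nhds (s := {z b}ᶜ))
      simpa using h2
    · filter_upwards [self_mem_nhdsWithin] with w hw
      exact sub_ne_zero.2 hw
  have hlim : Filter.Tendsto (fun w => ∑ c, (w - z b) • Dm N τ (w - z c) (A c))
      (nhdsWithin (z b) {z b}ᶜ) (nhds (∑ c, if c = b then A b else 0)) := by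
    refine tendsto_finsetSum _ fun c _ => ?_
    split_ifs with hc
    · subst hc
      exact (Dm_residue hτ hN (hA c)).comp hsub
    · have h1 : ContinuousAt (fun w => Dm N τ (w - z c) (A c)) (z b) :=
        ContinuousAt.comp (f := fun w : ℂ => w - z c) (g := fun w => Dm N τ w (A c))
          (Dm_continuousAt hτ hN (hz b c (Ne.symm hc)) (A c)) (by fun_prop)
      have h2 := (hsub.mono_right nhdsWithin_le_nhds).smul (h1.tendsto.mono_left (nhdsWithin_le_nhds (s := {z b}ᶜ)))
      simpa using h2
  have hev : ∀ᶠ w in nhdsWithin (z b) {z b}ᶜ, ∀ c, w - z c ∉ latticeGamma τ :=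
    Filter.eventually_all.2 fun c => eventually_not_mem hτ (z b) (z c)
  have hlim0 : Filter.Tendsto (fun w => ∑ c, (w - z b) • Dm N τ (w - z c) (A c))
      (nhdsWithin (z b) {z b}ᶜ) (nhds 0) := by
    refine tendsto_const_nhds.congr' ?_
    filter_upwards [hev] with w hw
    rw [← Finset.smul_sum, h w hw, smul_zero]
  have := tendsto_nhds_unique hlim hlim0
  simpa using this

/-- **Proposition 3.1** (first flows of the 1+1 elliptic sl(N) Gaudin hierarchy):
the zero-curvature equation `∂_t L − k ∂_x M_a = [L, M_a]` holds iff the field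
equations of motion hold. -/
theorem field_elliptic_gaudin_first_flow
    (τ : ℂ) (hτ : 0 < τ.im) (N : ℕ) (hN : 2 ≤ N)
    (n : ℕ) (z : Fin n → ℂ)
    (hz : ∀ a c : Fin n, a ≠ c → z a - z c ∉ latticeGamma τ)
    (a : Fin n) (k : ℂ)
    (S : Fin n → (ℤ × ℤ) → ℝ → ℝ → ℂ)
    (hS : ∀ c γ, ContDiff ℝ 1 (fun p : ℝ × ℝ => S c γ p.1 p.2)) :
    (∀ x t : ℝ, ∀ w : ℂ, (∀ c : Fin n, w - z c ∉ latticeGamma τ) →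
        (∑ c : Fin n, ∑ γ ∈ GammaN' N,
            (deriv (fun t' => S c γ x t') t * phiG N τ γ (w - z c)) • Tm N γ)
          - k • (∑ γ ∈ GammaN' N,
              (deriv (fun x' => S a γ x' t) x * phiG N τ γ (w - z a)) • Tm N γ)
          = (∑ c : Fin n, ∑ γ ∈ GammaN' N, (S c γ x t * phiG N τ γ (w - z c)) • Tm N γ)
                * phiHatS2 N τ S (w - z a) a x t
              - phiHatS2 N τ S (w - z a) a x t
                * (∑ c : Fin n, ∑ γ ∈ GammaN' N,
                    (S c γ x t * phiG N τ γ (w - z c)) • Tm N γ))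
    ↔ ((∀ x t : ℝ,
          (∑ γ ∈ GammaN' N, deriv (fun t' => S a γ x t') t • Tm N γ)
            - k • (∑ γ ∈ GammaN' N, deriv (fun x' => S a γ x' t) x • Tm N γ)
            = -(∑ c ∈ Finset.univ.filter (fun c => c ≠ a),
                (Smat2 N S a x t * phiHatS2 N τ S (z a - z c) c x t
                  - phiHatS2 N τ S (z a - z c) c x t * Smat2 N S a x t)))
        ∧ (∀ x t : ℝ, ∀ b : Fin n, b ≠ a →
            (∑ γ ∈ GammaN' N, deriv (fun t' => S b γ x t') t • Tm N γ)
              = Smat2 N S b x t * phiHatS2 N τ S (z b - z a) a x t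
                  - phiHatS2 N τ S (z b - z a) a x t * Smat2 N S b x t)) := by
  have hN0 : N ≠ 0 := by omega
  have hpt : ∀ x t : ℝ,
      (∀ w : ℂ, (∀ c : Fin n, w - z c ∉ latticeGamma τ) →
        (∑ c : Fin n, ∑ γ ∈ GammaN' N,
            (deriv (fun t' => S c γ x t') t * phiG N τ γ (w - z c)) • Tm N γ)
          - k • (∑ γ ∈ GammaN' N,
              (deriv (fun x' => S a γ x' t) x * phiG N τ γ (w - z a)) • Tm N γ)
          = (∑ c : Fin n, ∑ γ ∈ GammaN' N, (S c γ x t * phiG N τ γ (w - z c)) • Tm N γ)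
                * phiHatS2 N τ S (w - z a) a x t
              - phiHatS2 N τ S (w - z a) a x t
                * (∑ c : Fin n, ∑ γ ∈ GammaN' N,
                    (S c γ x t * phiG N τ γ (w - z c)) • Tm N γ))
      ↔ ∀ c, Am N τ z a k (fun c => ∑ γ ∈ GammaN' N, deriv (fun t' => S c γ x t') t • Tm N γ)
          (fun c => Smat2 N S c x t)
          (∑ γ ∈ GammaN' N, deriv (fun x' => S a γ x' t) x • Tm N γ) c = 0 := by
    intro x t
    have hSV : ∀ c, Smat2 N S c x t ∈ Vm N := fun c => sum_mem_V hN0 _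
    simp only [phiHatS2, ← Dm_sum hτ hN0]
    constructor
    · intro h c
      refine residues_zero hτ hN0 hz (Am_mem hN0 τ z a k (fun c => sum_mem_V hN0 _) hSV (sum_mem_V hN0 _)) ?_ c
      intro w hw
      rw [← zc_identity hτ hN0 hz a k hSV hw]
      exact sub_eq_zero.2 (h w hw)
    · intro h w hw
      refine sub_eq_zero.1 ((zc_identity hτ hN0 hz a k hSV hw).trans ?_)
      exact Finset.sum_eq_zero fun c _ => by rw [h c, map_zero]
  have hhat : ∀ (w : ℂ) (c : Fin n) (x t : ℝ), phiHatS2 N τ S w c x t = Dm N τ w (Smat2 N S c x t) :=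
    fun w c x t => (Dm_sum hτ hN0 w _).symm
  refine (forall_congr' fun x => forall_congr' fun t => hpt x t).trans ?_
  simp only [hhat]
  constructor
  · intro h
    refine ⟨fun x t => ?_, fun x t b hb => ?_⟩
    · have := h x t a
      rw [Am, if_pos rfl] at this
      exact eq_neg_of_add_eq_zero_left this
    · have := h x t b
      rw [Am, if_neg hb] at this
      exact sub_eq_zero.1 this
  · rintro ⟨h1, h2⟩ x t c
    rw [Am]
    split_ifs with hc
    · exact add_eq_zero_iff_eq_neg.2 (h1 x t)
    · exact sub_eq_zero.2 (h2 x t c hc)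

end
end
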